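/- arXiv:0706.0888 — 5 statements merged into one kernel-verified Lean document; each statement's English description precedes it below -/
import Mathlib

section
/- Let ∇ be the bi-Legendrian connection of an almost bi-Legendrian manifold (M^{2n+1},η,L₁,L₂). Its torsion tensor T satisfies: (i) T(X,X') = -[X,X']_{L₂} for X,X' ∈ Γ(L₁); (ii) T(Y,Y') = -[Y,Y']_{L₁} for Y,Y' ∈ Γ(L₂); (iii) T(X,Y) = 2dη(X,Y)ξ for X ∈ Γ(L₁), Y ∈ Γ(L₂); (iv) T(W,ξ) = [ξ,W_{L₁}]_{L₂} + [ξ,W_{L₂}]_{L₁} for all vector fields W. In particular, if L₁ and L₂ are flat then T(W,ξ) = 0 for all W, and if L₁ and L₂ are integrable then ∇ is torsion free along the leaves of the corresponding Legendrian foliations. -/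
/-!
Abstract framework for the calculus of smooth vector fields on a smooth
manifold `M`.  The commutative `ℝ`-algebra `F` plays the role of the ring
`C^∞(M)` of smooth real-valued functions, and the `F`-module `V` plays the
role of the `C^∞(M)`-module of smooth vector fields, together with the
action of vector fields on functions by derivations and the Lie bracket of
vector fields.
-/

structure VFCalculus (F V : Type*) [CommRing F] [Algebra ℝ F]
    [AddCommGroup V] [Module F V] where
  act : V → F → F
  act_add_left : ∀ X Y f, act (X + Y) f = act X f + act Y f
  act_smul_left : ∀ (f : F) (X : V) (g : F), act (f • X) g = f * act X g
  act_add_right : ∀ X f g, act X (f + g) = act X f + act X g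
  act_mul_right : ∀ X f g, act X (f * g) = act X f * g + f * act X g
  act_const : ∀ X (r : ℝ), act X (algebraMap ℝ F r) = 0
  bracket : V → V → V
  bracket_antisymm : ∀ X Y, bracket X Y = - bracket Y X
  bracket_add_left : ∀ X Y Z, bracket (X + Y) Z = bracket X Z + bracket Y Z
  bracket_smul_right : ∀ (f : F) (X Y : V),
    bracket X (f • Y) = act X f • Y + f • bracket X Y
  act_bracket : ∀ X Y f, act (bracket X Y) f = act X (act Y f) - act Y (act X f)
  jacobi : ∀ X Y Z,
    bracket X (bracket Y Z) + bracket Y (bracket Z X) + bracket Z (bracket X Y) = 0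

variable {F V : Type*} [CommRing F] [Algebra ℝ F] [AddCommGroup V] [Module F V]

/-- A linear (Koszul) connection on the tangent bundle. -/
def VFCalculus.IsConnection (C : VFCalculus F V) (D : V → V → V) : Prop :=
  (∀ X Y Z, D (X + Y) Z = D X Z + D Y Z) ∧
  (∀ (f : F) (X Y : V), D (f • X) Y = f • D X Y) ∧
  (∀ X Y Z, D X (Y + Z) = D X Y + D X Z) ∧
  (∀ (f : F) (X Y : V), D X (f • Y) = C.act X f • Y + f • D X Y)

/-- The torsion tensor of a connection. -/
def VFCalculus.torsion (C : VFCalculus F V) (D : V → V → V) (X Y : V) : V :=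
  D X Y - D Y X - C.bracket X Y

/-- The curvature tensor of a connection. -/
def VFCalculus.curvature (C : VFCalculus F V) (D : V → V → V) (X Y Z : V) : V :=
  D X (D Y Z) - D Y (D X Z) - D (C.bracket X Y) Z

/-- A contact form `η` on an odd-dimensional manifold, together with its Reeb
vector field `ξ`: `η(ξ) = 1`, `dη(ξ,·) = 0`, and `dη` is nondegenerate on the
contact distribution `D = ker η` (this encodes `η ∧ (dη)ⁿ ≠ 0`). -/
structure ContactForm (C : VFCalculus F V) where
  η : V → F
  η_add : ∀ X Y, η (X + Y) = η X + η Y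
  η_smul : ∀ (f : F) (X : V), η (f • X) = f * η X
  ξ : V
  η_ξ : η ξ = 1
  dη_ξ : ∀ X, C.act ξ (η X) = η (C.bracket ξ X)
  nondeg : ∀ X, η X = 0 →
    (∀ Y, η Y = 0 → C.act X (η Y) - C.act Y (η X) - η (C.bracket X Y) = 0) → X = 0

/-- The exterior differential of the contact form, with the convention
`2 u ∧ v = u ⊗ v - v ⊗ u`, so that
`dη(X,Y) = (1/2) (X(η Y) - Y(η X) - η [X,Y])`. -/
noncomputable def dEta (C : VFCalculus F V) (S : ContactForm C) (X Y : V) : F :=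
  algebraMap ℝ F (1 / 2) * (C.act X (S.η Y) - C.act Y (S.η X) - S.η (C.bracket X Y))

/-- A Legendrian distribution: an `n`-dimensional subbundle of the contact
distribution on which `dη` vanishes; `n`-dimensionality is encoded as maximal
isotropy of each fibre inside the symplectic vector space `(ker η, dη)`. -/
def IsLegendrian (C : VFCalculus F V) (S : ContactForm C) (L : Submodule F V) : Prop :=
  (∀ X ∈ L, S.η X = 0) ∧
  (∀ X ∈ L, ∀ Y ∈ L, dEta C S X Y = 0) ∧
  (∀ X, S.η X = 0 → (∀ Y ∈ L, dEta C S X Y = 0) → X ∈ L)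

/-- A distribution is flat when `[ξ, X] ∈ Γ(L)` for all `X ∈ Γ(L)`. -/
def IsFlatDistrib (C : VFCalculus F V) (S : ContactForm C) (L : Submodule F V) : Prop :=
  ∀ X ∈ L, C.bracket S.ξ X ∈ L

/-- A distribution is integrable when it is stable under the Lie bracket. -/
def IsIntegrableDistrib (C : VFCalculus F V) (L : Submodule F V) : Prop :=
  ∀ X ∈ L, ∀ Y ∈ L, C.bracket X Y ∈ L

/-- The data of an almost bi-Legendrian structure: the two (Legendrian)
distributions `L₁`, `L₂` are transversal, i.e. `TM = L₁ ⊕ L₂ ⊕ ℝξ`, as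
expressed by the associated projection operators `p1`, `p2`. -/
structure BiLegProj (C : VFCalculus F V) (S : ContactForm C)
    (L1 L2 : Submodule F V) where
  p1 : V →ₗ[F] V
  p2 : V →ₗ[F] V
  p1_mem : ∀ X, p1 X ∈ L1
  p2_mem : ∀ X, p2 X ∈ L2
  decomp : ∀ X, X = p1 X + p2 X + S.η X • S.ξ
  p1_of_mem1 : ∀ X ∈ L1, p1 X = X
  p2_of_mem2 : ∀ Y ∈ L2, p2 Y = Y
  p1_of_mem2 : ∀ Y ∈ L2, p1 Y = 0
  p2_of_mem1 : ∀ X ∈ L1, p2 X = 0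
  p1_ξ : p1 S.ξ = 0
  p2_ξ : p2 S.ξ = 0

/-- The characterizing properties of the bi-Legendrian connection of an almost
bi-Legendrian manifold `(M, η, L₁, L₂)`:  it preserves `L₁`, `L₂` and `ℝξ`,
it parallelizes `dη`, and its torsion satisfies `T(X,Y) = 2dη(X,Y)ξ` for
`X ∈ Γ(L₁)`, `Y ∈ Γ(L₂)` and
`T(V,ξ) = [ξ, V_{L₁}]_{L₂} + [ξ, V_{L₂}]_{L₁}` for all `V`. -/
def IsBiLegConnection (C : VFCalculus F V) (S : ContactForm C)
    (L1 L2 : Submodule F V) (B : BiLegProj C S L1 L2) (D : V → V → V) : Prop :=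
  C.IsConnection D ∧
  (∀ U X, X ∈ L1 → D U X ∈ L1) ∧
  (∀ U Y, Y ∈ L2 → D U Y ∈ L2) ∧
  (∀ U, D U S.ξ ∈ Submodule.span F {S.ξ}) ∧
  (∀ U X Y, C.act U (dEta C S X Y) = dEta C S (D U X) Y + dEta C S X (D U Y)) ∧
  (∀ X ∈ L1, ∀ Y ∈ L2, C.torsion D X Y = (2 * dEta C S X Y) • S.ξ) ∧
  (∀ W, C.torsion D W S.ξ =
    B.p2 (C.bracket S.ξ (B.p1 W)) + B.p1 (C.bracket S.ξ (B.p2 W)))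

/-- A contact metric structure `(φ, ξ, η, g)`. -/
structure ContactMetric (C : VFCalculus F V) extends ContactForm C where
  φ : V →ₗ[F] V
  g : V → V → F
  g_symm : ∀ X Y, g X Y = g Y X
  g_add_left : ∀ X Y Z, g (X + Y) Z = g X Z + g Y Z
  g_smul_left : ∀ (f : F) (X Y : V), g (f • X) Y = f * g X Y
  φ_sq : ∀ X, φ (φ X) = -X + η X • ξ
  φ_ξ : φ ξ = 0
  η_φ : ∀ X, η (φ X) = 0
  g_ξ : ∀ X, g X ξ = η X
  compat : ∀ X Y, dEta C toContactForm X Y = g X (φ Y)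

/-- The tensor field `h = (1/2) L_ξ φ`. -/
noncomputable def hTensor (C : VFCalculus F V) (M : ContactMetric C) (X : V) : V :=
  algebraMap ℝ F (1 / 2) • (C.bracket M.ξ (M.φ X) - M.φ (C.bracket M.ξ X))

/-- The Lie derivative of the metric: `(L_X g)(Y,Z)`. -/
def lieDerivG (C : VFCalculus F V) (M : ContactMetric C) (X Y Z : V) : F :=
  C.act X (M.g Y Z) - M.g (C.bracket X Y) Z - M.g Y (C.bracket X Z)

/-- `g` is bundle-like with respect to the distribution `E`:
`(L_Z g)(Y,Y') = 0` whenever `Z` is a section of `E` and `Y`, `Y'` are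
sections of the `g`-orthogonal complement of `E`. -/
def IsBundleLike (C : VFCalculus F V) (M : ContactMetric C) (E : Submodule F V) : Prop :=
  ∀ Z ∈ E, ∀ Y Y' : V, (∀ U ∈ E, M.g Y U = 0) → (∀ U ∈ E, M.g Y' U = 0) →
    lieDerivG C M Z Y Y' = 0

/-- `∇ g = 0`. -/
def MetricCompat (C : VFCalculus F V) (M : ContactMetric C) (D : V → V → V) : Prop :=
  ∀ U X Y, C.act U (M.g X Y) = M.g (D U X) Y + M.g X (D U Y)

/-- `∇ φ = 0`. -/
def PhiCompat (C : VFCalculus F V) (M : ContactMetric C) (D : V → V → V) : Prop :=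
  ∀ U X, D U (M.φ X) = M.φ (D U X)

/-- `∇ η = 0`. -/
def EtaCompat (C : VFCalculus F V) (S : ContactForm C) (D : V → V → V) : Prop :=
  ∀ U X, C.act U (S.η X) = S.η (D U X)

/-- `D` is the Levi-Civita connection of `g`: the unique torsion-free metric
connection. -/
def IsLeviCivita (C : VFCalculus F V) (M : ContactMetric C) (D : V → V → V) : Prop :=
  C.IsConnection D ∧ (∀ X Y, C.torsion D X Y = 0) ∧ MetricCompat C M D

/-- The Sasakian condition, written via the Levi-Civita connection `lc`:
`(∇̂_V φ) W = g(V,W) ξ - η(W) V`. -/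
def IsSasakian (C : VFCalculus F V) (M : ContactMetric C) (lc : V → V → V) : Prop :=
  ∀ X Y, lc X (M.φ Y) - M.φ (lc X Y) = M.g X Y • M.ξ - M.η Y • X

/-- K-contact: the Reeb vector field is Killing. -/
def IsKContact (C : VFCalculus F V) (M : ContactMetric C) : Prop :=
  ∀ Y Z, lieDerivG C M M.ξ Y Z = 0

/-- The generalized Tanaka-Webster connection of a contact metric manifold:
`*∇_V W = ∇̂_V W + η(V) φW + η(W)(φV + φhV) + dη(V + hV, W) ξ`. -/
noncomputable def tanakaWebster (C : VFCalculus F V) (M : ContactMetric C) (lc : V → V → V)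
    (X Y : V) : V :=
  lc X Y + M.η X • M.φ Y + M.η Y • (M.φ X + M.φ (hTensor C M X)) +
    dEta C M.toContactForm (X + hTensor C M X) Y • M.ξ

/-- A symplectic form on an (abstract) even-dimensional manifold. -/
structure SymplForm (C : VFCalculus F V) where
  ω : V → V → F
  ω_add_left : ∀ X Y Z, ω (X + Y) Z = ω X Z + ω Y Z
  ω_smul_left : ∀ (f : F) (X Y : V), ω (f • X) Y = f * ω X Y
  ω_antisymm : ∀ X Y, ω X Y = - ω Y X
  closed : ∀ X Y Z,
    C.act X (ω Y Z) - C.act Y (ω X Z) + C.act Z (ω X Y) -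
      ω (C.bracket X Y) Z + ω (C.bracket X Z) Y - ω (C.bracket Y Z) X = 0
  nondeg : ∀ X, (∀ Y, ω X Y = 0) → X = 0

/-- A Lagrangian distribution: an `n`-dimensional subbundle on which `ω`
vanishes; `n`-dimensionality is encoded as fibrewise maximal isotropy. -/
def IsLagrangian (C : VFCalculus F V) (S : SymplForm C) (L : Submodule F V) : Prop :=
  (∀ X ∈ L, ∀ Y ∈ L, S.ω X Y = 0) ∧
  (∀ X, (∀ Y ∈ L, S.ω X Y = 0) → X ∈ L)

/-- The characterizing properties of the bi-Lagrangian (Hess) connection of a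
pair of transversal Lagrangian distributions: the unique symplectic connection
preserving both distributions with `T(X,Y) = 0` for `X ∈ Γ(L₁)`, `Y ∈ Γ(L₂)`. -/
def IsBiLagConnection (C : VFCalculus F V) (S : SymplForm C)
    (L1 L2 : Submodule F V) (D : V → V → V) : Prop :=
  C.IsConnection D ∧
  (∀ U X Y, C.act U (S.ω X Y) = S.ω (D U X) Y + S.ω X (D U Y)) ∧
  (∀ U X, X ∈ L1 → D U X ∈ L1) ∧
  (∀ U Y, Y ∈ L2 → D U Y ∈ L2) ∧
  (∀ X ∈ L1, ∀ Y ∈ L2, C.torsion D X Y = 0)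

namespace VFCalculus

theorem act_neg_right (C : VFCalculus F V) (X : V) (f : F) : C.act X (-f) = -C.act X f :=
  (AddMonoidHom.mk' (C.act X) (C.act_add_right X)).map_neg f

theorem act_sub_right (C : VFCalculus F V) (X : V) (f g : F) :
    C.act X (f - g) = C.act X f - C.act X g :=
  (AddMonoidHom.mk' (C.act X) (C.act_add_right X)).map_sub f g

theorem act_algebraMap_mul (C : VFCalculus F V) (X : V) (r : ℝ) (f : F) :
    C.act X (algebraMap ℝ F r * f) = algebraMap ℝ F r * C.act X f := by
  rw [C.act_mul_right, C.act_const, zero_mul, zero_add]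

theorem torsion_antisymm (C : VFCalculus F V) (D : V → V → V) (X Y : V) :
    C.torsion D X Y = -C.torsion D Y X := by
  unfold torsion
  rw [C.bracket_antisymm X Y]
  abel

end VFCalculus

namespace ContactForm

variable {C : VFCalculus F V} (S : ContactForm C)

theorem η_neg (X : V) : S.η (-X) = -S.η X :=
  (AddMonoidHom.mk' S.η S.η_add).map_neg X

theorem η_zero : S.η 0 = 0 :=
  (AddMonoidHom.mk' S.η S.η_add).map_zero

theorem dEta_antisymm (X Y : V) : dEta C S X Y = -dEta C S Y X := by
  unfold dEta
  rw [C.bracket_antisymm X Y, S.η_neg]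
  ring

theorem dEta_add_left (X Y Z : V) :
    dEta C S (X + Y) Z = dEta C S X Z + dEta C S Y Z := by
  unfold dEta
  rw [C.bracket_add_left, S.η_add, S.η_add, C.act_add_left, C.act_add_right]
  ring

theorem dEta_sub_left (X Y Z : V) :
    dEta C S (X - Y) Z = dEta C S X Z - dEta C S Y Z :=
  (AddMonoidHom.mk' (dEta C S · Z) (S.dEta_add_left · · Z)).map_sub X Y

theorem dEta_smul_right (f : F) (X Y : V) :
    dEta C S X (f • Y) = f * dEta C S X Y := by
  unfold dEta
  rw [C.bracket_smul_right, S.η_add, S.η_smul, S.η_smul, S.η_smul, C.act_smul_left,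
    C.act_mul_right]
  ring

theorem dEta_smul_ξ_left (f : F) (X : V) : dEta C S (f • S.ξ) X = 0 := by
  have act_one : C.act X 1 = 0 := by simpa using C.act_const X 1
  rw [S.dEta_antisymm, S.dEta_smul_right, S.dEta_antisymm, dEta, S.η_ξ, act_one, S.dη_ξ]
  ring

theorem η_bracket_eq_zero {X Y : V} (hX : S.η X = 0) (hY : S.η Y = 0)
    (h : dEta C S X Y = 0) : S.η (C.bracket X Y) = 0 := by
  have act_zero (U : V) : C.act U 0 = 0 := by simpa using C.act_const U 0
  have two_mul_half : (2 : F) * algebraMap ℝ F (1 / 2) = 1 := by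
    rw [← map_ofNat (algebraMap ℝ F) 2, ← map_mul]
    norm_num
  rw [dEta, hX, hY, act_zero, act_zero] at h
  linear_combination -S.η (C.bracket X Y) * two_mul_half - 2 * h

/-- The 2-form `dη` is closed. -/
theorem dEta_closed (X Y Z : V) :
    C.act X (dEta C S Y Z) + C.act Y (dEta C S Z X) + C.act Z (dEta C S X Y) =
      dEta C S (C.bracket X Y) Z + dEta C S (C.bracket Y Z) X +
        dEta C S (C.bracket Z X) Y := by
  have jacobi := congrArg S.η (C.jacobi X Y Z)
  rw [S.η_add, S.η_add, S.η_zero, C.bracket_antisymm X (C.bracket Y Z),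
    C.bracket_antisymm Y (C.bracket Z X), C.bracket_antisymm Z (C.bracket X Y),
    S.η_neg, S.η_neg, S.η_neg] at jacobi
  simp only [dEta, C.act_algebraMap_mul, C.act_sub_right, C.act_bracket]
  linear_combination -algebraMap ℝ F (1 / 2) * jacobi

/-- The first Bianchi-type identity satisfied by the torsion of a connection with `∇dη = 0`. -/
theorem dEta_torsion_cyclic {D : V → V → V}
    (hD : ∀ U X Y, C.act U (dEta C S X Y) = dEta C S (D U X) Y + dEta C S X (D U Y))
    (X Y Z : V) :
    dEta C S (C.torsion D X Y) Z + dEta C S (C.torsion D Y Z) X +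
      dEta C S (C.torsion D Z X) Y = 0 := by
  have closed := S.dEta_closed X Y Z
  rw [hD, hD, hD, S.dEta_antisymm Y (D X Z), S.dEta_antisymm Z (D Y X),
    S.dEta_antisymm X (D Z Y)] at closed
  simp only [VFCalculus.torsion, S.dEta_sub_left]
  linear_combination closed

end ContactForm

section BiLegendrian

variable {C : VFCalculus F V} {S : ContactForm C} {L1 L2 : Submodule F V}

/-- The projections of an almost bi-Legendrian structure with the distributions interchanged. -/
def BiLegProj.swap (B : BiLegProj C S L1 L2) : BiLegProj C S L2 L1 where
  p1 := B.p2
  p2 := B.p1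
  p1_mem := B.p2_mem
  p2_mem := B.p1_mem
  decomp X := by
    rw [add_comm (B.p2 X)]
    exact B.decomp X
  p1_of_mem1 := B.p2_of_mem2
  p2_of_mem2 := B.p1_of_mem1
  p1_of_mem2 := B.p2_of_mem1
  p2_of_mem1 := B.p1_of_mem2
  p1_ξ := B.p2_ξ
  p2_ξ := B.p1_ξ

theorem IsBiLegConnection.swap {B : BiLegProj C S L1 L2} {D : V → V → V}
    (hD : IsBiLegConnection C S L1 L2 B D) : IsBiLegConnection C S L2 L1 B.swap D := by
  obtain ⟨conn, h1, h2, hξ, hdη, hT, hTξ⟩ := hD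
  refine ⟨conn, h2, h1, hξ, hdη, fun Y hY X hX => ?_, fun W => ?_⟩
  · rw [C.torsion_antisymm, hT X hX Y hY, S.dEta_antisymm, ← neg_smul]
    congr 1
    ring
  · rw [hTξ W]
    exact add_comm _ _

theorem IsBiLegConnection.torsion_of_mem (hL1 : IsLegendrian C S L1) (hL2 : IsLegendrian C S L2)
    {B : BiLegProj C S L1 L2} {D : V → V → V} (hD : IsBiLegConnection C S L1 L2 B D)
    {X X' : V} (hX : X ∈ L1) (hX' : X' ∈ L1) :
    C.torsion D X X' = -B.p2 (C.bracket X X') := by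
  obtain ⟨-, h1, -, -, hdη, hT, -⟩ := hD
  set A := D X X' - D X' X - B.p1 (C.bracket X X')
  have hA : A ∈ L1 := sub_mem (sub_mem (h1 _ _ hX') (h1 _ _ hX)) (B.p1_mem _)
  have hTA : C.torsion D X X' = A - B.p2 (C.bracket X X') := by
    have decomp := B.decomp (C.bracket X X')
    rw [S.η_bracket_eq_zero (hL1.1 X hX) (hL1.1 X' hX') (hL1.2.1 X hX X' hX'), zero_smul,
      add_zero] at decomp
    rw [VFCalculus.torsion, decomp, ← sub_sub, ← decomp]
  have hA2 : A ∈ L2 := by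
    refine hL2.2.2 A (hL1.1 A hA) fun Y hY => ?_
    have cyclic := S.dEta_torsion_cyclic hdη X X' Y
    rw [C.torsion_antisymm D Y X, hT X hX Y hY, hT X' hX' Y hY, ← neg_smul,
      S.dEta_smul_ξ_left, S.dEta_smul_ξ_left, hTA, S.dEta_sub_left,
      hL2.2.1 _ (B.p2_mem _) Y hY] at cyclic
    simpa using cyclic
  have hA0 : A = 0 := by rw [← B.p1_of_mem1 A hA, B.p1_of_mem2 A hA2]
  rw [hTA, hA0, zero_sub]

end BiLegendrian

/-- torsion of the bi-Legendrian connection.  For the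
bi-Legendrian connection `∇` of an almost bi-Legendrian manifold
`(M, η, L₁, L₂)`: (i) `T(X,X') = -[X,X']_{L₂}` for `X, X' ∈ Γ(L₁)`;
(ii) `T(Y,Y') = -[Y,Y']_{L₁}` for `Y, Y' ∈ Γ(L₂)`;
(iii) `T(X,Y) = 2dη(X,Y)ξ` for `X ∈ Γ(L₁)`, `Y ∈ Γ(L₂)`;
(iv) `T(W,ξ) = [ξ,W_{L₁}]_{L₂} + [ξ,W_{L₂}]_{L₁}` for every `W`.
In particular, if `L₁` and `L₂` are flat then `T(W,ξ) = 0` for all `W`, and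
if `L₁` and `L₂` are integrable then `∇` is torsion-free along the leaves of
the corresponding Legendrian foliations. -/
theorem biLegendrian_torsion
    (C : VFCalculus F V) (S : ContactForm C) (L1 L2 : Submodule F V)
    (hL1 : IsLegendrian C S L1) (hL2 : IsLegendrian C S L2)
    (B : BiLegProj C S L1 L2) (D : V → V → V)
    (hD : IsBiLegConnection C S L1 L2 B D) :
    (∀ X ∈ L1, ∀ X' ∈ L1, C.torsion D X X' = - B.p2 (C.bracket X X')) ∧
    (∀ Y ∈ L2, ∀ Y' ∈ L2, C.torsion D Y Y' = - B.p1 (C.bracket Y Y')) ∧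
    (∀ X ∈ L1, ∀ Y ∈ L2, C.torsion D X Y = (2 * dEta C S X Y) • S.ξ) ∧
    (∀ W, C.torsion D W S.ξ =
      B.p2 (C.bracket S.ξ (B.p1 W)) + B.p1 (C.bracket S.ξ (B.p2 W))) ∧
    ((IsFlatDistrib C S L1 ∧ IsFlatDistrib C S L2) →
      ∀ W, C.torsion D W S.ξ = 0) ∧
    ((IsIntegrableDistrib C L1 ∧ IsIntegrableDistrib C L2) →
      (∀ X ∈ L1, ∀ X' ∈ L1, C.torsion D X X' = 0) ∧
      (∀ Y ∈ L2, ∀ Y' ∈ L2, C.torsion D Y Y' = 0)) := by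
  have hT1 : ∀ X ∈ L1, ∀ X' ∈ L1, C.torsion D X X' = -B.p2 (C.bracket X X') :=
    fun _ hX _ hX' => hD.torsion_of_mem hL1 hL2 hX hX'
  have hT2 : ∀ Y ∈ L2, ∀ Y' ∈ L2, C.torsion D Y Y' = -B.p1 (C.bracket Y Y') :=
    fun _ hY _ hY' => hD.swap.torsion_of_mem hL2 hL1 hY hY'
  obtain ⟨-, -, -, -, -, hT, hTξ⟩ := hD
  refine ⟨hT1, hT2, hT, hTξ, fun ⟨flat1, flat2⟩ W => ?_, fun ⟨int1, int2⟩ => ⟨?_, ?_⟩⟩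
  · rw [hTξ, B.p2_of_mem1 _ (flat1 _ (B.p1_mem W)), B.p1_of_mem2 _ (flat2 _ (B.p2_mem W)),
      add_zero]
  · intro X hX X' hX'
    rw [hT1 X hX X' hX', B.p2_of_mem1 _ (int1 X hX X' hX'), neg_zero]
  · intro Y hY Y' hY'
    rw [hT2 Y hY Y' hY', B.p1_of_mem2 _ (int2 Y hY Y' hY'), neg_zero]
end

section
/- Let (M^{2n+1},φ,ξ,η,g) be a contact metric manifold endowed with a Legendrian distribution L with conjugate Legendrian distribution Q = φL, and assume the pair (L,Q) is flat (both L and Q are flat) and that the associated bi-Legendrian connection ∇ satisfies ∇g = 0. Then ∇ coincides with the generalized Tanaka-Webster connection *∇ of (M^{2n+1},φ,ξ,η,g) if and only if L and Q are integrable and (M^{2n+1},φ,ξ,η,g) is a Sasakian manifold. -/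
variable {F V : Type*} [CommRing F] [Algebra ℝ F] [AddCommGroup V] [Module F V]

theorem half_mul_two (F : Type*) [CommRing F] [Algebra ℝ F] :
    algebraMap ℝ F (1 / 2) * 2 = 1 := by
  rw [← map_ofNat (algebraMap ℝ F) 2, ← map_mul]
  norm_num

theorem eq_zero_of_eq_neg_self {x : F} (h : x = -x) : x = 0 := by
  linear_combination algebraMap ℝ F (1 / 2) * h - x * half_mul_two F

theorem dEta_antisymm (C : VFCalculus F V) (S : ContactForm C) (X Y : V) :
    dEta C S X Y = -dEta C S Y X := by
  have hneg : S.η (-C.bracket Y X) = -S.η (C.bracket Y X) := by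
    simpa using S.η_smul (-1) (C.bracket Y X)
  simp only [dEta, C.bracket_antisymm X Y, hneg]
  ring

namespace VFCalculus.IsConnection

variable {C : VFCalculus F V} {D : V → V → V}

theorem torsion_add_left (h : C.IsConnection D) (X Y Z : V) :
    C.torsion D (X + Y) Z = C.torsion D X Z + C.torsion D Y Z := by
  simp only [VFCalculus.torsion, h.1, h.2.2.1, C.bracket_add_left]
  abel

theorem torsion_smul_right (h : C.IsConnection D) (f : F) (X Y : V) :
    C.torsion D X (f • Y) = f • C.torsion D X Y := by
  simp only [VFCalculus.torsion, h.2.1, h.2.2.2, C.bracket_smul_right]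
  module

end VFCalculus.IsConnection

theorem VFCalculus.torsion_antisymm_s7 (C : VFCalculus F V) (D : V → V → V) (X Y : V) :
    C.torsion D X Y = -C.torsion D Y X := by
  simp only [VFCalculus.torsion, C.bracket_antisymm X Y]
  abel

namespace ContactMetric

variable {C : VFCalculus F V} (M : ContactMetric C)

theorem g_add_right (X Y Z : V) : M.g X (Y + Z) = M.g X Y + M.g X Z := by
  rw [M.g_symm, M.g_add_left, M.g_symm Y, M.g_symm Z]

theorem g_smul_right (f : F) (X Y : V) : M.g X (f • Y) = f * M.g X Y := by
  rw [M.g_symm, M.g_smul_left, M.g_symm]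

theorem g_zero_right (X : V) : M.g X 0 = 0 := by
  simpa using M.g_smul_right 0 X 0

theorem g_neg_right (X Y : V) : M.g X (-Y) = -M.g X Y := by
  simpa using M.g_smul_right (-1) X Y

theorem g_sub_right (X Y Z : V) : M.g X (Y - Z) = M.g X Y - M.g X Z := by
  rw [sub_eq_add_neg, M.g_add_right, M.g_neg_right, sub_eq_add_neg]

theorem g_sub_left (X Y Z : V) : M.g (X - Y) Z = M.g X Z - M.g Y Z := by
  rw [M.g_symm, M.g_sub_right, M.g_symm Z, M.g_symm Z]

theorem g_φ_antisymm (X Y : V) : M.g X (M.φ Y) = -M.g Y (M.φ X) := by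
  rw [← M.compat, ← M.compat, dEta_antisymm]

theorem g_φ_left (X Y : V) : M.g (M.φ X) Y = -M.g X (M.φ Y) := by
  rw [M.g_symm, M.g_φ_antisymm]

theorem ξ_g (X : V) : M.g M.ξ X = M.η X := by
  rw [M.g_symm, M.g_ξ]

theorem eq_zero_of_g_left_eq_zero {X : V} (h : ∀ Y, M.g Y X = 0) : X = 0 := by
  refine M.nondeg X ?_ fun Y _ => ?_
  · rw [← M.ξ_g, h]
  · have hd : dEta C M.toContactForm X Y = 0 := by
      rw [M.compat, M.g_symm, h]
    rw [dEta] at hd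
    linear_combination 2 * hd - (C.act X (M.η Y) - C.act Y (M.η X) - M.η (C.bracket X Y)) *
      half_mul_two F

theorem dEta_φ_φ_eq_zero {X Y : V} (hY : M.η Y = 0)
    (h : dEta C M.toContactForm X Y = 0) :
    dEta C M.toContactForm (M.φ X) (M.φ Y) = 0 := by
  rw [M.compat] at h
  rw [M.compat, M.φ_sq, hY, zero_smul, add_zero, M.g_neg_right, M.g_φ_left, h, neg_zero, neg_zero]

end ContactMetric

section

variable {C : VFCalculus F V} {M : ContactMetric C} {D : V → V → V}

/-- A metric connection preserving `ℝξ` parallelizes `ξ`. -/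
theorem MetricCompat.map_ξ (hg : MetricCompat C M D)
    (hξ : ∀ U, D U M.ξ ∈ Submodule.span F {M.ξ}) (U : V) : D U M.ξ = 0 := by
  obtain ⟨c, hc⟩ := Submodule.mem_span_singleton.1 (hξ U)
  have h := hg U M.ξ M.ξ
  have h1 : C.act U 1 = 0 := by simpa using C.act_const U 1
  rw [← hc, M.g_smul_left, M.g_smul_right, M.g_ξ, M.η_ξ, h1] at h
  have : c = 0 := eq_zero_of_eq_neg_self (by linear_combination -h)
  rw [← hc, this, zero_smul]

/-- A metric connection parallelizing `dη` parallelizes `φ`. -/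
theorem MetricCompat.phiCompat (hg : MetricCompat C M D)
    (hd : ∀ U X Y, C.act U (dEta C M.toContactForm X Y) =
      dEta C M.toContactForm (D U X) Y + dEta C M.toContactForm X (D U Y)) :
    PhiCompat C M D := by
  intro U Y
  rw [← sub_eq_zero]
  refine M.eq_zero_of_g_left_eq_zero fun X => ?_
  have h := hd U X Y
  simp only [M.compat] at h
  rw [M.g_sub_right]
  linear_combination h - hg U X (M.φ Y)

/-- The Tanaka-Webster connection when `h = 0`. -/
theorem tanakaWebster_of_hTensor_eq_zero (lc : V → V → V) (hh : ∀ X, hTensor C M X = 0)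
    (X Y : V) :
    tanakaWebster C M lc X Y =
      lc X Y + M.η X • M.φ Y + M.η Y • M.φ X + M.g X (M.φ Y) • M.ξ := by
  simp only [tanakaWebster, hh, map_zero, add_zero, M.compat]

/-- If `h = 0`, the Tanaka-Webster connection parallelizes `φ` exactly on Sasakian manifolds. -/
theorem phiCompat_tanakaWebster_iff_isSasakian (lc : V → V → V)
    (hh : ∀ X, hTensor C M X = 0) :
    PhiCompat C M (tanakaWebster C M lc) ↔ IsSasakian C M lc := by
  refine forall₂_congr fun X Y => ?_
  rw [← sub_eq_zero, ← sub_eq_zero (b := M.g X Y • M.ξ - M.η Y • X)]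
  refine Eq.congr ?_ rfl
  simp only [tanakaWebster_of_hTensor_eq_zero lc hh, map_add, map_smul, M.φ_sq, M.φ_ξ, M.η_φ,
    M.g_add_right, M.g_neg_right, M.g_smul_right, M.g_ξ]
  module

theorem torsion_tanakaWebster {lc : V → V → V} (hlc : ∀ X Y, C.torsion lc X Y = 0)
    (hh : ∀ X, hTensor C M X = 0) (X Y : V) :
    C.torsion (tanakaWebster C M lc) X Y = (2 * dEta C M.toContactForm X Y) • M.ξ := by
  have h := hlc X Y
  rw [VFCalculus.torsion, sub_sub, sub_eq_zero] at h
  rw [VFCalculus.torsion, tanakaWebster_of_hTensor_eq_zero lc hh,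
    tanakaWebster_of_hTensor_eq_zero lc hh, h, M.compat, M.g_φ_antisymm Y X]
  module

theorem metricCompat_tanakaWebster {lc : V → V → V} (hlc : MetricCompat C M lc)
    (hh : ∀ X, hTensor C M X = 0) : MetricCompat C M (tanakaWebster C M lc) := by
  intro U X Y
  simp only [hlc U X Y, tanakaWebster_of_hTensor_eq_zero lc hh, M.g_add_left, M.g_add_right,
    M.g_smul_left, M.g_smul_right, M.g_ξ, M.ξ_g]
  linear_combination -M.η U * M.g_φ_left X Y - M.η X * M.g_φ_left U Y - M.η Y * M.g_φ_antisymm X U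

/-- Metric connections are determined by their torsion. -/
theorem MetricCompat.ext_torsion {D' : V → V → V} (hD : MetricCompat C M D)
    (hD' : MetricCompat C M D') (h : ∀ X Y, C.torsion D X Y = C.torsion D' X Y) (X Y : V) :
    D X Y = D' X Y := by
  have hsymm : ∀ X Y, D X Y - D' X Y = D Y X - D' Y X := fun X Y => by
    have := h X Y
    simp only [VFCalculus.torsion, sub_left_inj] at this
    rw [sub_eq_sub_iff_add_eq_add] at this ⊢
    rw [add_comm (D Y X), ← this]
  have hskew : ∀ X Y Z, M.g (D X Y - D' X Y) Z = -M.g (D X Z - D' X Z) Y := fun X Y Z => by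
    rw [M.g_sub_left, M.g_sub_left, M.g_symm (D X Z), M.g_symm (D' X Z)]
    linear_combination hD' X Y Z - hD X Y Z
  rw [← sub_eq_zero]
  refine M.eq_zero_of_g_left_eq_zero fun Z => eq_zero_of_eq_neg_self ?_
  rw [M.g_symm]
  calc M.g (D X Y - D' X Y) Z = -M.g (D Z X - D' Z X) Y := by rw [hskew, hsymm]
    _ = M.g (D Y Z - D' Y Z) X := by rw [hskew, hsymm, neg_neg]
    _ = -M.g (D X Y - D' X Y) Z := by rw [hskew, hsymm]

end

section

variable {C : VFCalculus F V} {S : ContactForm C} {L₁ L₂ : Submodule F V}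

theorem BiLegProj.eq_zero_of_mem (B : BiLegProj C S L₁ L₂) {X : V} (h₁ : X ∈ L₁) (h₂ : X ∈ L₂) :
    X = 0 := by
  rw [← B.p1_of_mem1 X h₁, B.p1_of_mem2 X h₂]

/-- The bi-Legendrian connection of a flat pair has `T(·,ξ) = 0`. -/
theorem IsBiLegConnection.torsion_ξ_of_flat {B : BiLegProj C S L₁ L₂} {D : V → V → V}
    (hD : IsBiLegConnection C S L₁ L₂ B D) (h₁ : IsFlatDistrib C S L₁)
    (h₂ : IsFlatDistrib C S L₂) (W : V) : C.torsion D W S.ξ = 0 := by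
  obtain ⟨-, -, -, -, -, -, hT⟩ := hD
  rw [hT, B.p2_of_mem1 _ (h₁ _ (B.p1_mem W)), B.p1_of_mem2 _ (h₂ _ (B.p2_mem W)), add_zero]

/-- An antisymmetric biadditive map on vector fields vanishing on `L₁ × L₁`, `L₁ × L₂`,
`L₂ × L₂` and on multiples of `ξ` vanishes identically. -/
theorem BiLegProj.eq_zero_of_antisymm (B : BiLegProj C S L₁ L₂) {T : V → V → V}
    (hanti : ∀ X Y, T X Y = -T Y X) (hadd : ∀ X Y Z, T (X + Y) Z = T X Z + T Y Z)
    (h₁₁ : ∀ X ∈ L₁, ∀ Y ∈ L₁, T X Y = 0) (h₁₂ : ∀ X ∈ L₁, ∀ Y ∈ L₂, T X Y = 0)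
    (h₂₂ : ∀ X ∈ L₂, ∀ Y ∈ L₂, T X Y = 0) (hξ : ∀ X (f : F), T X (f • S.ξ) = 0) (X Y : V) :
    T X Y = 0 := by
  have hadd' : ∀ X Y Z, T X (Y + Z) = T X Y + T X Z := fun X Y Z => by
    rw [hanti, hadd, neg_add, ← hanti, ← hanti]
  rw [B.decomp X, B.decomp Y]
  simp only [hadd, hadd', hξ, hanti (S.η X • S.ξ), h₁₁ _ (B.p1_mem X) _ (B.p1_mem Y),
    h₁₂ _ (B.p1_mem X) _ (B.p2_mem Y), hanti (B.p2 X) (B.p1 Y),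
    h₁₂ _ (B.p1_mem Y) _ (B.p2_mem X), h₂₂ _ (B.p2_mem X) _ (B.p2_mem Y), neg_zero, add_zero]

/-- An isotropic distribution preserved by a connection whose torsion has values
in `ℝξ` is integrable. -/
theorem isIntegrableDistrib_of_torsion {M : ContactMetric C} {L : Submodule F V} {D : V → V → V}
    (hiso : ∀ X ∈ L, ∀ Y ∈ L, dEta C M.toContactForm X Y = 0)
    (hpres : ∀ U, ∀ X ∈ L, D U X ∈ L)
    (hT : ∀ X Y, C.torsion D X Y = (2 * dEta C M.toContactForm X Y) • M.ξ) :
    IsIntegrableDistrib C L := by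
  intro X hX Y hY
  have h := hT X Y
  rw [hiso X hX Y hY, mul_zero, zero_smul, VFCalculus.torsion, sub_eq_zero] at h
  rw [← h]
  exact L.sub_mem (hpres X Y hY) (hpres Y X hX)

end

/-- Theorem: when the bi-Legendrian connection coincides with
the Tanaka-Webster connection.  Let `(M, φ, ξ, η, g)` be a contact metric
manifold endowed with a Legendrian distribution `L` with conjugate `Q = φL`;
assume both `L` and `Q` are flat and the bi-Legendrian connection `∇`
associated to `(L, Q)` satisfies `∇g = 0`.  Then `∇` coincides with the
generalized Tanaka-Webster connection `*∇` if and only if `L` and `Q` are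
integrable and `(M, φ, ξ, η, g)` is Sasakian. -/
theorem biLegendrian_eq_tanakaWebster_iff
    (C : VFCalculus F V) (M : ContactMetric C) (L : Submodule F V)
    (hL : IsLegendrian C M.toContactForm L)
    (hLflat : IsFlatDistrib C M.toContactForm L)
    (hQflat : IsFlatDistrib C M.toContactForm (Submodule.map M.φ L))
    (B : BiLegProj C M.toContactForm L (Submodule.map M.φ L))
    (D : V → V → V)
    (hD : IsBiLegConnection C M.toContactForm L (Submodule.map M.φ L) B D)
    (hg : MetricCompat C M D)
    (lc : V → V → V) (hlc : IsLeviCivita C M lc) :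
    (∀ X Y, D X Y = tanakaWebster C M lc X Y) ↔
      (IsIntegrableDistrib C L ∧ IsIntegrableDistrib C (Submodule.map M.φ L) ∧
        IsSasakian C M lc) := by
  obtain ⟨hLη, hLiso, -⟩ := hL
  have hTξ := hD.torsion_ξ_of_flat hLflat hQflat
  obtain ⟨hconn, hDL, hDQ, hDξ, hDd, hTLQ, -⟩ := hD
  have hDφ : PhiCompat C M D := hg.phiCompat hDd
  have hh : ∀ X, hTensor C M X = 0 := by
    have hDlie : ∀ W, C.bracket M.ξ W = D M.ξ W := fun W => by
      have h := hTξ W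
      rw [VFCalculus.torsion, hg.map_ξ hDξ, C.bracket_antisymm, sub_neg_eq_add, zero_sub] at h
      exact (neg_add_eq_zero.1 h).symm
    intro X
    rw [hTensor, hDlie, hDlie, hDφ, sub_self, smul_zero]
  have hTW := torsion_tanakaWebster hlc.2.1 hh
  constructor
  · intro h
    obtain rfl : D = tanakaWebster C M lc := funext₂ h
    refine ⟨isIntegrableDistrib_of_torsion hLiso (fun U X => hDL U X) hTW,
      isIntegrableDistrib_of_torsion ?_ (fun U X => hDQ U X) hTW,
      (phiCompat_tanakaWebster_iff_isSasakian lc hh).1 hDφ⟩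
    rintro _ ⟨X, hX, rfl⟩ _ ⟨Y, hY, rfl⟩
    exact M.dEta_φ_φ_eq_zero (hLη Y hY) (hLiso X hX Y hY)
  · rintro ⟨hLint, hQint, hS⟩
    have hTWφ := (phiCompat_tanakaWebster_iff_isSasakian lc hh).2 hS
    refine hg.ext_torsion (metricCompat_tanakaWebster hlc.2.2 hh) fun X Y => ?_
    rw [hTW, ← sub_eq_zero]
    have hQiso : ∀ X ∈ L, ∀ Y ∈ L, dEta C M.toContactForm (M.φ X) (M.φ Y) = 0 :=
      fun X hX Y hY => M.dEta_φ_φ_eq_zero (hLη Y hY) (hLiso X hX Y hY)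
    let A : V → V → V := fun X Y => D X Y - tanakaWebster C M lc X Y
    have hTA : ∀ X Y, C.torsion D X Y - (2 * dEta C M.toContactForm X Y) • M.ξ =
        A X Y - A Y X := fun X Y => by
      rw [← hTW]
      simp only [VFCalculus.torsion, A]
      abel
    have hAφ : ∀ X Y, A X (M.φ Y) = M.φ (A X Y) := fun X Y => by
      simp only [A, hDφ X Y, hTWφ X Y, map_sub]
    have hALQ : ∀ X ∈ L, ∀ Y ∈ L, A X (M.φ Y) = A (M.φ Y) X := fun X hX Y hY => by
      rw [← sub_eq_zero, ← hTA, hTLQ X hX _ (Submodule.mem_map_of_mem hY), sub_self]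
    have hAQQ : ∀ X ∈ L, ∀ Y ∈ L, A (M.φ Y) (M.φ X) = M.φ (M.φ (A X Y)) := fun X hX Y hY => by
      rw [hAφ, ← hALQ X hX Y hY, hAφ]
    have hT : ∀ X ∈ L, ∀ Y ∈ L, C.torsion D X Y ∈ L := fun X hX Y hY =>
      L.sub_mem (L.sub_mem (hDL X Y hY) (hDL Y X hX)) (hLint X hX Y hY)
    have hTQ : ∀ X ∈ L, ∀ Y ∈ L, C.torsion D (M.φ Y) (M.φ X) = -C.torsion D X Y :=
      fun X hX Y hY => by
        have h₁ := hTA X Y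
        have h₂ := hTA (M.φ Y) (M.φ X)
        rw [hLiso X hX Y hY, mul_zero, zero_smul, sub_zero] at h₁
        rw [hQiso Y hY X hX, mul_zero, zero_smul, sub_zero] at h₂
        rw [h₂, hAQQ X hX Y hY, hAQQ Y hY X hX, ← map_sub, ← map_sub, ← h₁, M.φ_sq,
          hLη _ (hT X hX Y hY), zero_smul, add_zero]
    have hTL : ∀ X ∈ L, ∀ Y ∈ L, C.torsion D X Y = 0 := fun X hX Y hY => by
      refine B.eq_zero_of_mem (hT X hX Y hY) ?_
      rw [← neg_mem_iff, ← hTQ X hX Y hY]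
      have hX' := Submodule.mem_map_of_mem (f := M.φ) hX
      have hY' := Submodule.mem_map_of_mem (f := M.φ) hY
      exact Submodule.sub_mem _ (Submodule.sub_mem _ (hDQ _ _ hX') (hDQ _ _ hY'))
        (hQint _ hY' _ hX')
    refine B.eq_zero_of_antisymm
      (T := fun X Y => C.torsion D X Y - (2 * dEta C M.toContactForm X Y) • M.ξ)
      (fun X Y => ?_) (fun X Y Z => ?_) (fun X hX Y hY => ?_) (fun X hX Y hY => ?_) ?_
      (fun X f => ?_) X Y
    · simp only [C.torsion_antisymm_s7 D X Y, dEta_antisymm C M.toContactForm X Y]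
      module
    · simp only [hconn.torsion_add_left, M.compat, M.g_add_left]
      module
    · simp only [hTL X hX Y hY, hLiso X hX Y hY, mul_zero, zero_smul, sub_zero]
    · simp only [hTLQ X hX Y hY, sub_self]
    · rintro _ ⟨X, hX, rfl⟩ _ ⟨Y, hY, rfl⟩
      simp only [hTQ Y hY X hX, hTL Y hY X hX, hQiso X hX Y hY, mul_zero, zero_smul, sub_zero,
        neg_zero]
    · simp only [hconn.torsion_smul_right, hTξ, M.compat, map_smul, M.φ_ξ, smul_zero,
        M.g_zero_right, mul_zero, zero_smul, sub_zero]
end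

section
/- Let (M^{2n+1},φ,ξ,η,g) be a Sasakian manifold endowed with a flat integrable Legendrian distribution L whose conjugate Legendrian distribution Q = φL is flat and integrable, and whose associated bi-Legendrian connection ∇ satisfies ∇g = 0. Then the Tanaka-Webster connection *∇ of (M^{2n+1},φ,ξ,η,g) satisfies *∇_X X' = −(φ[X,φX'])_L for all X,X' ∈ Γ(L) and *∇_Y Y' = −(φ[Y,φY'])_Q for all Y,Y' ∈ Γ(Q). -/
variable {F V : Type*} [CommRing F] [Algebra ℝ F] [AddCommGroup V] [Module F V]

theorem VFCalculus.act_zero (C : VFCalculus F V) (X : V) : C.act X 0 = 0 := by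
  simpa using C.act_const X 0

theorem VFCalculus.act_one (C : VFCalculus F V) (X : V) : C.act X 1 = 0 := by
  simpa using C.act_const X 1

theorem algebraMap_half_mul_two : algebraMap ℝ F (1 / 2) * 2 = 1 := by
  have h : algebraMap ℝ F (1 / 2 * 2) = algebraMap ℝ F (1 / 2) * 2 := by
    rw [map_mul, map_ofNat]
  rw [← h]
  norm_num

/-- Twice an element of a real algebra vanishes only if the element does. -/
theorem eq_zero_of_add_self_eq_zero {a : F} (h : a + a = 0) : a = 0 := by
  have h2 := algebraMap_half_mul_two (F := F)
  linear_combination (algebraMap ℝ F (1 / 2)) * h - a * h2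

namespace ContactMetric

variable {C : VFCalculus F V} (M : ContactMetric C)

theorem g_neg_left (X Y : V) : M.g (-X) Y = -M.g X Y := by
  rw [← neg_one_smul F X, M.g_smul_left, neg_one_mul]

/-- The metric is nondegenerate on the contact distribution. -/
theorem eq_zero_of_g_eq_zero {X : V} (hη : M.η X = 0) (h : ∀ U, M.g X U = 0) : X = 0 := by
  refine M.nondeg X hη fun Y _ => ?_
  have h1 := M.compat X Y
  rw [h, dEta] at h1
  have h2 := algebraMap_half_mul_two (F := F)
  linear_combination 2 * h1 -
    (C.act X (M.η Y) - C.act Y (M.η X) - M.η (C.bracket X Y)) * h2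

variable {M} {lc : V → V → V}

/-- On a Sasakian manifold `∇̂_X ξ = -φX`. -/
theorem leviCivita_ξ (hlc : IsLeviCivita C M lc) (hSas : IsSasakian C M lc) (X : V) :
    lc X M.ξ = -M.φ X := by
  obtain ⟨⟨-, -, -, hleib⟩, -, hmet⟩ := hlc
  have h0 : lc X 0 = 0 := by
    have := hleib 0 X 0
    simpa [C.act_zero] using this
  have hη : M.η (lc X M.ξ) = 0 := by
    have h1 := hmet X M.ξ M.ξ
    rw [M.g_symm M.ξ (lc X M.ξ), M.g_ξ, M.g_ξ, M.η_ξ, C.act_one] at h1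
    exact eq_zero_of_add_self_eq_zero h1.symm
  have h2 := congrArg M.φ (hSas X M.ξ)
  rw [M.φ_ξ, h0, zero_sub, map_neg, M.φ_sq, hη, zero_smul, add_zero, neg_neg, map_sub,
    map_smul, M.φ_ξ, smul_zero, M.η_ξ, one_smul, zero_sub] at h2
  exact h2

/-- On a Sasakian manifold the tensor `h` vanishes. -/
theorem hTensor_eq_zero (hlc : IsLeviCivita C M lc) (hSas : IsSasakian C M lc) (X : V) :
    hTensor C M X = 0 := by
  have hb : ∀ Y, C.bracket M.ξ Y = lc M.ξ Y + M.φ Y := fun Y => by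
    have h := hlc.2.1 M.ξ Y
    rw [VFCalculus.torsion, leviCivita_ξ hlc hSas, sub_neg_eq_add] at h
    exact (sub_eq_zero.mp h).symm
  have h := hSas M.ξ X
  rw [M.g_symm, M.g_ξ, sub_self] at h
  rw [hTensor, hb, hb, map_add, add_sub_add_right_eq_sub, h, smul_zero]

end ContactMetric

/-- Leaves of an integrable distribution `E₁` are totally geodesic along `E₂`, when a metric
connection preserves the orthogonal distributions `E₁`, `E₂` of the contact distribution and
its mixed torsion is proportional to the Reeb field. -/
theorem g_leviCivita_eq_zero {C : VFCalculus F V} {M : ContactMetric C} {E₁ E₂ : Submodule F V}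
    {D lc : V → V → V}
    (hη₁ : ∀ X ∈ E₁, M.η X = 0) (horth : ∀ X ∈ E₁, ∀ Y ∈ E₂, M.g X Y = 0)
    (hint : IsIntegrableDistrib C E₁) (hD₂ : ∀ U, ∀ Y ∈ E₂, D U Y ∈ E₂)
    (hT : ∀ X ∈ E₁, ∀ Y ∈ E₂, C.torsion D X Y ∈ Submodule.span F {M.ξ})
    (hg : MetricCompat C M D) (hlc : IsLeviCivita C M lc)
    {X X' Y : V} (hX : X ∈ E₁) (hX' : X' ∈ E₁) (hY : Y ∈ E₂) :
    M.g (lc X X') Y = 0 := by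
  obtain ⟨-, htf, hmet⟩ := hlc
  have hbr : ∀ A B, C.bracket A B = lc A B - lc B A := fun A B =>
    (sub_eq_zero.mp (htf A B)).symm
  have hsym : M.g (lc X X') Y = M.g (lc X' X) Y := by
    have h := horth _ (hint X hX X' hX') Y hY
    rw [hbr, M.g_sub_left] at h
    exact sub_eq_zero.mp h
  have hmixed : ∀ A ∈ E₁, ∀ A' ∈ E₁, M.g A' (C.bracket A Y) = -M.g A' (D Y A) := by
    intro A hA A' hA'
    obtain ⟨f, hf⟩ := Submodule.mem_span_singleton.mp (hT A hA Y hY)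
    have h : C.bracket A Y = D A Y - D Y A - f • M.ξ := by
      rw [hf, VFCalculus.torsion]
      abel
    rw [h, M.g_sub_right, M.g_sub_right, M.g_smul_right, M.g_ξ, hη₁ A' hA',
      horth A' hA' _ (hD₂ A Y hY)]
    ring
  have hskew : ∀ A ∈ E₁, ∀ A' ∈ E₁,
      M.g (lc A A') Y = -M.g A' (lc Y A) + M.g A' (D Y A) := by
    intro A hA A' hA'
    have h1 := hmet A A' Y
    rw [horth A' hA' Y hY, C.act_zero] at h1
    have h2 := hmixed A hA A' hA'
    rw [hbr, M.g_sub_right] at h2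
    linear_combination -h1 - h2
  apply eq_zero_of_add_self_eq_zero
  have h1 := hskew X hX X' hX'
  have h2 := hskew X' hX' X hX
  have h3 := hmet Y X X'
  have h4 := hg Y X X'
  rw [M.g_symm (lc Y X)] at h3
  rw [M.g_symm (D Y X)] at h4
  linear_combination hsym + h1 + h2 + h3 - h4

/-- The Tanaka-Webster connection along the leaves of one of two orthogonal integrable
distributions splitting the contact distribution of a Sasakian manifold and interchanged
by `φ`. -/
theorem tanakaWebster_eq_neg_proj {C : VFCalculus F V} {M : ContactMetric C}
    {E₁ E₂ : Submodule F V} {D lc : V → V → V} (p₁ p₂ : V →ₗ[F] V)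
    (hp₂ : ∀ X, p₂ X ∈ E₂) (hp₁ : ∀ X, p₁ X ∈ E₁)
    (hdecomp : ∀ X, X = p₁ X + p₂ X + M.η X • M.ξ)
    (hp₁₂ : ∀ Y ∈ E₂, p₁ Y = 0)
    (hη₁ : ∀ X ∈ E₁, M.η X = 0) (hη₂ : ∀ Y ∈ E₂, M.η Y = 0)
    (hφ₁ : ∀ X ∈ E₁, M.φ X ∈ E₂)
    (horth : ∀ X ∈ E₁, ∀ Y ∈ E₂, M.g X Y = 0)
    (hint₁ : IsIntegrableDistrib C E₁) (hint₂ : IsIntegrableDistrib C E₂)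
    (hD₁ : ∀ U, ∀ X ∈ E₁, D U X ∈ E₁) (hD₂ : ∀ U, ∀ Y ∈ E₂, D U Y ∈ E₂)
    (hT : ∀ X ∈ E₁, ∀ Y ∈ E₂, C.torsion D X Y ∈ Submodule.span F {M.ξ})
    (hT' : ∀ Y ∈ E₂, ∀ X ∈ E₁, C.torsion D Y X ∈ Submodule.span F {M.ξ})
    (hg : MetricCompat C M D) (hlc : IsLeviCivita C M lc) (hSas : IsSasakian C M lc)
    {X X' : V} (hX : X ∈ E₁) (hX' : X' ∈ E₁) :
    tanakaWebster C M lc X X' = -p₁ (M.φ (C.bracket X (M.φ X'))) := by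
  have hp₂_zero : ∀ W, (∀ Y ∈ E₂, M.g W Y = 0) → p₂ W = 0 := by
    intro W hW
    refine M.eq_zero_of_g_eq_zero (hη₂ _ (hp₂ W)) fun U => ?_
    have h := hW _ (hp₂ U)
    nth_rewrite 1 [hdecomp W] at h
    rw [M.g_add_left, M.g_add_left, horth _ (hp₁ W) _ (hp₂ U), M.g_smul_left,
      M.g_symm M.ξ, M.g_ξ, hη₂ _ (hp₂ U), mul_zero, add_zero, zero_add] at h
    rw [hdecomp U, M.g_add_right, M.g_add_right, h, M.g_symm _ (p₁ U),
      horth _ (hp₁ U) _ (hp₂ W), M.g_smul_right, M.g_ξ, hη₂ _ (hp₂ W)]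
    ring
  have hφX' := hφ₁ X' hX'
  have hηW : M.η (lc X X') = 0 := by
    have h := hlc.2.2 X X' M.ξ
    rw [M.g_ξ, M.g_ξ, hη₁ X' hX', C.act_zero, ContactMetric.leviCivita_ξ hlc hSas,
      M.g_neg_right, horth X' hX' _ (hφ₁ X hX), neg_zero, add_zero] at h
    exact h.symm
  have hW : p₁ (lc X X') = lc X X' := by
    have h : p₂ (lc X X') = 0 := hp₂_zero _ fun Y hY =>
      g_leviCivita_eq_zero hη₁ horth hint₁ hD₂ hT hg hlc hX hX' hY
    have h1 := hdecomp (lc X X')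
    rw [h, hηW, zero_smul, add_zero, add_zero] at h1
    exact h1.symm
  have hZ : p₁ (M.φ (lc (M.φ X') X)) = 0 := by
    have h : p₂ (lc (M.φ X') X) = 0 := hp₂_zero _ fun Y hY => by
      have h1 := hlc.2.2 (M.φ X') X Y
      have h2 := g_leviCivita_eq_zero hη₂ (fun Y hY X hX => by rw [M.g_symm, horth X hX Y hY])
        hint₂ hD₁ hT' hg hlc hφX' hY hX
      rw [horth X hX Y hY, C.act_zero, M.g_symm X, h2, add_zero] at h1
      exact h1.symm
    rw [hdecomp (lc (M.φ X') X), h, add_zero, map_add, map_smul, M.φ_ξ, smul_zero, add_zero]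
    exact hp₁₂ _ (hφ₁ _ (hp₁ _))
  have hbr : M.φ (C.bracket X (M.φ X')) = -lc X X' - M.φ (lc (M.φ X') X) := by
    have h1 : C.bracket X (M.φ X') = lc X (M.φ X') - lc (M.φ X') X :=
      (sub_eq_zero.mp (hlc.2.1 X (M.φ X'))).symm
    have h2 : lc X (M.φ X') = M.φ (lc X X') + M.g X X' • M.ξ := by
      have h := hSas X X'
      rw [hη₁ X' hX', zero_smul, sub_zero] at h
      rw [← h]
      abel
    rw [h1, h2, map_sub, map_add, M.φ_sq, hηW, map_smul, M.φ_ξ]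
    simp
  rw [hbr, map_sub, map_neg, hW, hZ, sub_zero, neg_neg, tanakaWebster,
    ContactMetric.hTensor_eq_zero hlc hSas, hη₁ X hX, hη₁ X' hX', add_zero, M.compat,
    horth X hX _ hφX']
  simp

/-- Corollary.  Under the assumptions of Theorem
`biLegendrian_eq_tanakaWebster_iff` (a Sasakian manifold endowed with a flat
integrable Legendrian distribution `L`, with conjugate `Q = φL` flat and
integrable, whose bi-Legendrian connection satisfies `∇g = 0`), the
Tanaka-Webster connection satisfies `*∇_X X' = -(φ[X,φX'])_L` for all
`X, X' ∈ Γ(L)` and `*∇_Y Y' = -(φ[Y,φY'])_Q` for all `Y, Y' ∈ Γ(Q)`. -/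
theorem tanakaWebster_on_legendrian_leaves
    (C : VFCalculus F V) (M : ContactMetric C) (L : Submodule F V)
    (hL : IsLegendrian C M.toContactForm L)
    (hLflat : IsFlatDistrib C M.toContactForm L)
    (hLint : IsIntegrableDistrib C L)
    (hQflat : IsFlatDistrib C M.toContactForm (Submodule.map M.φ L))
    (hQint : IsIntegrableDistrib C (Submodule.map M.φ L))
    (B : BiLegProj C M.toContactForm L (Submodule.map M.φ L))
    (D : V → V → V)
    (hD : IsBiLegConnection C M.toContactForm L (Submodule.map M.φ L) B D)
    (hg : MetricCompat C M D)
    (lc : V → V → V) (hlc : IsLeviCivita C M lc)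
    (hSas : IsSasakian C M lc) :
    (∀ X ∈ L, ∀ X' ∈ L,
      tanakaWebster C M lc X X' = - B.p1 (M.φ (C.bracket X (M.φ X')))) ∧
    (∀ Y ∈ Submodule.map M.φ L, ∀ Y' ∈ Submodule.map M.φ L,
      tanakaWebster C M lc Y Y' = - B.p2 (M.φ (C.bracket Y (M.φ Y')))) := by
  obtain ⟨-, hD₁, hD₂, -, -, hT, -⟩ := hD
  have hηQ : ∀ Y ∈ Submodule.map M.φ L, M.η Y = 0 := by
    rintro _ ⟨X, -, rfl⟩
    exact M.η_φ X
  have hφL : ∀ X ∈ L, M.φ X ∈ Submodule.map M.φ L := fun X hX =>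
    Submodule.mem_map_of_mem hX
  have hφQ : ∀ Y ∈ Submodule.map M.φ L, M.φ Y ∈ L := by
    rintro _ ⟨X, hX, rfl⟩
    rw [M.φ_sq, hL.1 X hX, zero_smul, add_zero]
    exact neg_mem hX
  have horth : ∀ X ∈ L, ∀ Y ∈ Submodule.map M.φ L, M.g X Y = 0 := by
    rintro X hX _ ⟨X', hX', rfl⟩
    rw [← M.compat]
    exact hL.2.1 X hX X' hX'
  have hT₁ : ∀ X ∈ L, ∀ Y ∈ Submodule.map M.φ L,
      C.torsion D X Y ∈ Submodule.span F {M.ξ} := fun X hX Y hY => by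
    rw [hT X hX Y hY]
    exact Submodule.smul_mem _ _ (Submodule.mem_span_singleton_self _)
  have hT₂ : ∀ Y ∈ Submodule.map M.φ L, ∀ X ∈ L,
      C.torsion D Y X ∈ Submodule.span F {M.ξ} := fun Y hY X hX => by
    have h : C.torsion D Y X = -C.torsion D X Y := by
      rw [VFCalculus.torsion, VFCalculus.torsion, C.bracket_antisymm Y X]
      abel
    rw [h]
    exact neg_mem (hT₁ X hX Y hY)
  exact ⟨fun X hX X' hX' => tanakaWebster_eq_neg_proj B.p1 B.p2 B.p2_mem B.p1_mem B.decomp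
      B.p1_of_mem2 hL.1 hηQ hφL horth hLint hQint hD₁ hD₂ hT₁ hT₂ hg hlc hSas hX hX',
    fun Y hY Y' hY' => tanakaWebster_eq_neg_proj B.p2 B.p1 B.p1_mem B.p2_mem
      (fun X => by rw [add_comm (B.p2 X)]; exact B.decomp X)
      B.p2_of_mem1 hηQ hL.1 hφQ (fun Y hY X hX => by rw [M.g_symm, horth X hX Y hY])
      hQint hLint hD₂ hD₁ hT₂ hT₁ hg hlc hSas hY hY'⟩
end

section
/- Let (M^{2n+1},φ,ξ,η,g) be a Sasakian manifold endowed with a flat Legendrian distribution L, and let Q = φL be its conjugate Legendrian distribution. If the Tanaka-Webster connection *∇ preserves the distribution L (i.e. *∇_V X ∈ Γ(L) for all vector fields V and X ∈ Γ(L)), then L and Q are integrable and *∇ coincides with the bi-Legendrian connection ∇ associated to the almost bi-Legendrian structure (L,Q). -/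
variable {F V : Type*} [CommRing F] [Algebra ℝ F] [AddCommGroup V] [Module F V]

theorem ContactForm.η_neg_s11 {C : VFCalculus F V} (S : ContactForm C) (X : V) :
    S.η (-X) = -S.η X := by
  simpa using S.η_smul (-1) X

namespace ContactMetric

variable {C : VFCalculus F V} (M : ContactMetric C)

theorem g_φ_φ (X Y : V) : M.g (M.φ X) (M.φ Y) = M.g X Y - M.η X * M.η Y := by
  rw [g_φ_left, M.φ_sq, g_add_right, g_neg_right, g_smul_right, M.g_ξ]
  ring

variable {M} {lc : V → V → V}

theorem bracket_ξ_φ (hlc : IsLeviCivita C M lc) (hSas : IsSasakian C M lc) (X : V) :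
    C.bracket M.ξ (M.φ X) = M.φ (C.bracket M.ξ X) := by
  have hbr : ∀ Y, C.bracket M.ξ Y = lc M.ξ Y + M.φ Y := fun Y => by
    have h := hlc.2.1 M.ξ Y
    rw [VFCalculus.torsion, leviCivita_ξ hlc hSas, sub_eq_zero] at h
    rw [← h, sub_neg_eq_add]
  have h := hSas M.ξ X
  rw [M.g_symm, M.g_ξ, sub_self, sub_eq_zero] at h
  rw [hbr, hbr, map_add, h]

theorem tanakaWebster_eq (hlc : IsLeviCivita C M lc) (hSas : IsSasakian C M lc) (X Y : V) :
    tanakaWebster C M lc X Y =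
      lc X Y + M.η X • M.φ Y + M.η Y • M.φ X + M.g X (M.φ Y) • M.ξ := by
  have hh : hTensor C M X = 0 := by
    rw [hTensor, bracket_ξ_φ hlc hSas, sub_self, smul_zero]
  rw [tanakaWebster, hh, map_zero, add_zero, add_zero, M.compat]

theorem isConnection_tanakaWebster (hlc : IsLeviCivita C M lc) (hSas : IsSasakian C M lc) :
    C.IsConnection (tanakaWebster C M lc) := by
  obtain ⟨h1, h2, h3, h4⟩ := hlc.1
  refine ⟨fun X Y Z => ?_, fun f X Y => ?_, fun X Y Z => ?_, fun f X Y => ?_⟩ <;>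
    simp only [tanakaWebster_eq hlc hSas, h1, h2, h3, h4, M.η_add, M.η_smul, M.g_add_left,
      M.g_smul_left, map_add, map_smul, g_add_right, g_smul_right] <;>
    module

theorem tanakaWebster_ξ (hlc : IsLeviCivita C M lc) (hSas : IsSasakian C M lc) (X : V) :
    tanakaWebster C M lc X M.ξ = 0 := by
  simp [tanakaWebster_eq hlc hSas, leviCivita_ξ hlc hSas, M.φ_ξ, M.η_ξ, g_zero_right]

theorem phiCompat_tanakaWebster (hlc : IsLeviCivita C M lc) (hSas : IsSasakian C M lc) :
    PhiCompat C M (tanakaWebster C M lc) := by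
  intro U X
  have h := hSas U X
  rw [sub_eq_iff_eq_add] at h
  simp only [tanakaWebster_eq hlc hSas, h, map_add, map_smul, M.φ_sq, M.η_φ, M.φ_ξ,
    g_add_right, g_neg_right, g_smul_right, M.g_ξ]
  module

theorem metricCompat_tanakaWebster (hlc : IsLeviCivita C M lc) (hSas : IsSasakian C M lc) :
    MetricCompat C M (tanakaWebster C M lc) := by
  intro U X Y
  simp only [tanakaWebster_eq hlc hSas, hlc.2.2 U X Y, M.g_add_left, M.g_smul_left,
    g_add_right, g_smul_right, g_φ_left, M.g_ξ, M.g_symm M.ξ, M.g_symm X (M.φ U)]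
  ring

theorem torsion_tanakaWebster (hlc : IsLeviCivita C M lc) (hSas : IsSasakian C M lc) (X Y : V) :
    C.torsion (tanakaWebster C M lc) X Y = (2 * dEta C M.toContactForm X Y) • M.ξ := by
  have h := hlc.2.1 X Y
  rw [VFCalculus.torsion, sub_eq_zero] at h
  have hg : M.g Y (M.φ X) = -M.g X (M.φ Y) := by rw [M.g_symm, g_φ_left]
  rw [VFCalculus.torsion, ← h, tanakaWebster_eq hlc hSas, tanakaWebster_eq hlc hSas, M.compat, hg]
  module

/-- On a Sasakian manifold, an isotropic distribution preserved by the Tanaka-Webster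
connection is integrable. -/
theorem isIntegrableDistrib_of_preserves (hlc : IsLeviCivita C M lc) (hSas : IsSasakian C M lc)
    {E : Submodule F V} (hE : ∀ X ∈ E, ∀ Y ∈ E, dEta C M.toContactForm X Y = 0)
    (hpres : ∀ U, ∀ X ∈ E, tanakaWebster C M lc U X ∈ E) : IsIntegrableDistrib C E := by
  intro X hX Y hY
  have h := torsion_tanakaWebster hlc hSas X Y
  rw [hE X hX Y hY, mul_zero, zero_smul, VFCalculus.torsion, sub_eq_zero] at h
  exact h ▸ E.sub_mem (hpres X Y hY) (hpres Y X hX)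

end ContactMetric

/-- Theorem.  Let `(M, φ, ξ, η, g)` be a Sasakian manifold
endowed with a flat Legendrian distribution `L`, and let `Q = φL` be its
conjugate Legendrian distribution.  If the Tanaka-Webster connection `*∇`
preserves `L` (i.e. `*∇_V X ∈ Γ(L)` for all `V` and all `X ∈ Γ(L)`), then
`L` and `Q` are integrable and `*∇` coincides with the bi-Legendrian
connection associated to the almost bi-Legendrian structure `(L, Q)`. -/
theorem tanakaWebster_eq_biLegendrian_of_preserves
    (C : VFCalculus F V) (M : ContactMetric C)
    (lc : V → V → V) (hlc : IsLeviCivita C M lc) (hSas : IsSasakian C M lc)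
    (L : Submodule F V) (hL : IsLegendrian C M.toContactForm L)
    (hflat : IsFlatDistrib C M.toContactForm L)
    (B : BiLegProj C M.toContactForm L (Submodule.map M.φ L))
    (hpres : ∀ U : V, ∀ X ∈ L, tanakaWebster C M lc U X ∈ L) :
    IsIntegrableDistrib C L ∧
    IsIntegrableDistrib C (Submodule.map M.φ L) ∧
    IsBiLegConnection C M.toContactForm L (Submodule.map M.φ L) B
      (tanakaWebster C M lc) := by
  have hQ : ∀ U, ∀ Y ∈ Submodule.map M.φ L,
      tanakaWebster C M lc U Y ∈ Submodule.map M.φ L := by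
    rintro U _ ⟨X, hX, rfl⟩
    exact ⟨_, hpres U X hX, (ContactMetric.phiCompat_tanakaWebster hlc hSas U X).symm⟩
  have hQiso : ∀ X ∈ Submodule.map M.φ L, ∀ Y ∈ Submodule.map M.φ L,
      dEta C M.toContactForm X Y = 0 := by
    rintro _ ⟨X, hX, rfl⟩ _ ⟨Y, hY, rfl⟩
    rw [M.compat, M.g_φ_φ, M.η_φ, mul_zero, sub_zero, ← M.compat, hL.2.1 X hX Y hY]
  have hQflat : IsFlatDistrib C M.toContactForm (Submodule.map M.φ L) := by
    rintro _ ⟨X, hX, rfl⟩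
    exact ⟨_, hflat X hX, (ContactMetric.bracket_ξ_φ hlc hSas X).symm⟩
  refine ⟨ContactMetric.isIntegrableDistrib_of_preserves hlc hSas hL.2.1 hpres,
    ContactMetric.isIntegrableDistrib_of_preserves hlc hSas hQiso hQ,
    ContactMetric.isConnection_tanakaWebster hlc hSas, hpres, hQ, fun U => ?_, fun U X Y => ?_,
    fun X _ Y _ => ContactMetric.torsion_tanakaWebster hlc hSas X Y, fun W => ?_⟩
  · rw [ContactMetric.tanakaWebster_ξ hlc hSas]
    exact Submodule.zero_mem _
  · rw [M.compat, M.compat, M.compat, ContactMetric.metricCompat_tanakaWebster hlc hSas,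
      ContactMetric.phiCompat_tanakaWebster hlc hSas]
  · rw [B.p2_of_mem1 _ (hflat _ (B.p1_mem W)), B.p1_of_mem2 _ (hQflat _ (B.p2_mem W)), add_zero,
      ContactMetric.torsion_tanakaWebster hlc hSas, M.compat, M.φ_ξ, M.g_zero_right, mul_zero,
      zero_smul]
end

section
/- Consider ℝ^{2n+1} with its standard Sasakian structure (φ,ξ,η,g), where η = dz − Σ_{k=1}^n y_k dx_k, ξ = ∂/∂z, g = η⊗η + (1/2)Σ_{k=1}^n ((dx_k)² + (dy_k)²), and φ maps ∂/∂y_i to ∂/∂x_i + y_i ∂/∂z. Let L = span{∂/∂y_1,…,∂/∂y_n} and Q = span{∂/∂x_1 + y_1∂/∂z,…,∂/∂x_n + y_n∂/∂z} be the standard bi-Legendrian structure. Then L and Q are two orthogonal flat Legendrian foliations, the associated bi-Legendrian connection ∇ satisfies ∇φ = 0 and ∇g = 0 and coincides with the Tanaka-Webster connection of (ℝ^{2n+1},φ,ξ,η,g), and consequently the Tanaka-Webster connection of the standard Sasakian ℝ^{2n+1} is everywhere flat (its curvature vanishes identically). -/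
/-!
The standard Sasakian structure on `ℝ^{2n+1}`, with coordinates
`(x₁, …, xₙ, y₁, …, yₙ, z)`:
`η = dz - Σ yₖ dxₖ`, `ξ = ∂/∂z`,
`g = η ⊗ η + (1/2) Σ ((dxₖ)² + (dyₖ)²)`,
`φ(∂/∂yᵢ) = ∂/∂xᵢ + yᵢ ∂/∂z`, `φ(∂/∂xᵢ + yᵢ ∂/∂z) = -∂/∂yᵢ`, `φ ξ = 0`,
together with the standard bi-Legendrian structure
`L = span{∂/∂y₁, …, ∂/∂yₙ}`, `Q = span{∂/∂x₁ + y₁ ∂/∂z, …, ∂/∂xₙ + yₙ ∂/∂z}`.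
-/

open scoped BigOperators

noncomputable section

/-- Points of `ℝ^{2n+1}`, written `p = (x, y, z)`. -/
abbrev Pt (n : ℕ) := (Fin n → ℝ) × (Fin n → ℝ) × ℝ

/-- Vector fields on `ℝ^{2n+1}`. -/
abbrev VecF (n : ℕ) := Pt n → Pt n

/-- Real-valued functions on `ℝ^{2n+1}`. -/
abbrev Func (n : ℕ) := Pt n → ℝ

variable {n : ℕ}

/-- A smooth vector field. -/
def SmoothVF (W : VecF n) : Prop := ContDiff ℝ (⊤ : ℕ∞) W

/-- The action of a vector field on a function: the directional derivative. -/
def actD (X : VecF n) (f : Func n) : Func n := fun p => fderiv ℝ f p (X p)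

/-- The Lie bracket of vector fields on `ℝ^{2n+1}`. -/
def brkt (X Y : VecF n) : VecF n := fun p => fderiv ℝ Y p (X p) - fderiv ℝ X p (Y p)

/-- The torsion `T(X,Y) = ∇_X Y - ∇_Y X - [X,Y]` of a connection. -/
def torsionD (D : VecF n → VecF n → VecF n) (X Y : VecF n) : VecF n :=
  fun p => D X Y p - D Y X p - brkt X Y p

/-- The contact form `η = dz - Σ yₖ dxₖ`, evaluated on a vector field. -/
def ηstd (W : VecF n) : Func n := fun p => (W p).2.2 - ∑ k, p.2.1 k * (W p).1 k

/-- The Reeb vector field `ξ = ∂/∂z`. -/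
def ξstd : VecF n := fun _ => (0, 0, 1)

/-- `dη = Σ dxₖ ∧ dyₖ`, with the convention `2 u ∧ v = u ⊗ v - v ⊗ u`. -/
def dηstd (X Y : VecF n) : Func n := fun p =>
  (1 / 2) * ∑ k, ((X p).1 k * (Y p).2.1 k - (X p).2.1 k * (Y p).1 k)

/-- The standard Sasakian metric `g = η ⊗ η + (1/2) Σ ((dxₖ)² + (dyₖ)²)`. -/
def gstd (X Y : VecF n) : Func n := fun p =>
  ηstd X p * ηstd Y p +
    (1 / 2) * (∑ k, (X p).1 k * (Y p).1 k + ∑ k, (X p).2.1 k * (Y p).2.1 k)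

/-- The standard structure tensor `φ`: it maps `∂/∂yᵢ` to `∂/∂xᵢ + yᵢ ∂/∂z`,
`∂/∂xᵢ + yᵢ ∂/∂z` to `-∂/∂yᵢ`, and `ξ` to `0`. -/
def φstd (W : VecF n) : VecF n := fun p =>
  ((W p).2.1, -(W p).1, ∑ k, p.2.1 k * (W p).2.1 k)

/-- The tensor `h = (1/2) L_ξ φ`. -/
def hstd (W : VecF n) : VecF n := fun p =>
  (1 / 2 : ℝ) • (brkt ξstd (φstd W) p - φstd (brkt ξstd W) p)

/-- Sections of the standard Legendrian distribution `L = span{∂/∂yᵢ}`. -/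
def memL (W : VecF n) : Prop := ∀ p, (W p).1 = 0 ∧ (W p).2.2 = 0

/-- Sections of `Q = φL = span{∂/∂xᵢ + yᵢ ∂/∂z}`. -/
def memQ (W : VecF n) : Prop :=
  ∀ p, (W p).2.1 = 0 ∧ (W p).2.2 = ∑ k, (W p).1 k * p.2.1 k

/-- The projection onto `L`. -/
def projL (W : VecF n) : VecF n := fun p => (0, (W p).2.1, 0)

/-- The projection onto `Q`. -/
def projQ (W : VecF n) : VecF n := fun p => ((W p).1, 0, ∑ k, (W p).1 k * p.2.1 k)

/-- The bi-Legendrian connection associated to the standard bi-Legendrian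
structure `(L, Q)` on `ℝ^{2n+1}`: in the global frame `Xᵢ = ∂/∂yᵢ`,
`Yᵢ = ∂/∂xᵢ + yᵢ ∂/∂z`, `ξ` it differentiates the components, i.e.
`∇_Z (Σ uᵢ Yᵢ + Σ vᵢ Xᵢ + c ξ) = Σ Z(uᵢ) Yᵢ + Σ Z(vᵢ) Xᵢ + Z(c) ξ`. -/
def bilegStd (Z W : VecF n) : VecF n := fun p =>
  (fderiv ℝ (fun q => (W q).1) p (Z p),
   fderiv ℝ (fun q => (W q).2.1) p (Z p),
   (∑ k, fderiv ℝ (fun q => (W q).1) p (Z p) k * p.2.1 k) +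
     fderiv ℝ (fun q => (W q).2.2 - ∑ k, (W q).1 k * q.2.1 k) p (Z p))

/-- The generalized Tanaka-Webster connection
`*∇_V W = ∇̂_V W + η(V) φW + η(W)(φV + φhV) + dη(V + hV, W) ξ`,
built from a Levi-Civita connection `∇̂` of `g`. -/
def twStd (lc : VecF n → VecF n → VecF n) (X Y : VecF n) : VecF n := fun p =>
  lc X Y p + ηstd X p • φstd Y p + ηstd Y p • (φstd X p + φstd (hstd X) p) +
    dηstd (X + hstd X) Y p • ξstd p

theorem SmoothVF.differentiableAt {W : VecF n} (hW : SmoothVF W) (p : Pt n) :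
    DifferentiableAt ℝ W p :=
  (ContDiff.differentiable hW (by simp)).differentiableAt

theorem fderiv_dotProduct {a b : Pt n → Fin n → ℝ} {p : Pt n}
    (ha : DifferentiableAt ℝ a p) (hb : DifferentiableAt ℝ b p) (v : Pt n) :
    fderiv ℝ (fun q => ∑ k, a q k * b q k) p v =
      ∑ k, (fderiv ℝ a p v k * b p k + a p k * fderiv ℝ b p v k) := by
  have h := HasFDerivAt.fun_sum (u := Finset.univ) fun k _ =>
    ((hasFDerivAt_pi'.1 ha.hasFDerivAt) k).fun_mul ((hasFDerivAt_pi'.1 hb.hasFDerivAt) k)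
  rw [h.fderiv]
  simp only [sum_apply, add_apply, smul_apply, ContinuousLinearMap.comp_apply,
    ContinuousLinearMap.proj_apply, smul_eq_mul]
  exact Finset.sum_congr rfl fun k _ => by ring

theorem differentiableAt_dotProduct {a b : Pt n → Fin n → ℝ} {p : Pt n}
    (ha : DifferentiableAt ℝ a p) (hb : DifferentiableAt ℝ b p) :
    DifferentiableAt ℝ (fun q => ∑ k, a q k * b q k) p :=
  DifferentiableAt.fun_sum fun k _ =>
    (differentiableAt_pi.1 ha k).mul (differentiableAt_pi.1 hb k)

theorem fderiv_x {W : VecF n} {p : Pt n} (hW : DifferentiableAt ℝ W p) (v : Pt n) :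
    fderiv ℝ (fun q => (W q).1) p v = (fderiv ℝ W p v).1 := by
  rw [hW.hasFDerivAt.fst.fderiv]; rfl

theorem fderiv_y {W : VecF n} {p : Pt n} (hW : DifferentiableAt ℝ W p) (v : Pt n) :
    fderiv ℝ (fun q => (W q).2.1) p v = (fderiv ℝ W p v).2.1 := by
  rw [hW.hasFDerivAt.snd.fst.fderiv]; rfl

theorem fderiv_z {W : VecF n} {p : Pt n} (hW : DifferentiableAt ℝ W p) (v : Pt n) :
    fderiv ℝ (fun q => (W q).2.2) p v = (fderiv ℝ W p v).2.2 := by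
  rw [hW.hasFDerivAt.snd.snd.fderiv]; rfl

theorem differentiableAt_y (p : Pt n) : DifferentiableAt ℝ (fun q : Pt n => q.2.1) p :=
  differentiableAt_id.snd.fst

theorem fderiv_coord_y (p v : Pt n) : fderiv ℝ (fun q : Pt n => q.2.1) p v = v.2.1 := by
  simpa using fderiv_y (W := fun q : Pt n => q) differentiableAt_id v

/-- The bi-Legendrian connection differs from the coordinate derivative by a multiple of `ξ`. -/
theorem bilegStd_apply {W : VecF n} {p : Pt n} (hW : DifferentiableAt ℝ W p) (Z : VecF n) :
    bilegStd Z W p =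
      fderiv ℝ W p (Z p) - ((0, 0, ∑ k, (W p).1 k * (Z p).2.1 k) : Pt n) := by
  have hy := differentiableAt_y p
  refine Prod.ext ?_ (Prod.ext ?_ ?_)
  · simp [bilegStd, fderiv_x hW]
  · simp [bilegStd, fderiv_y hW]
  · simp only [bilegStd, fderiv_x hW, Prod.snd_sub]
    rw [fderiv_fun_sub hW.snd.snd (differentiableAt_dotProduct hW.fst hy),
      sub_apply, fderiv_z hW, fderiv_dotProduct hW.fst hy,
      fderiv_x hW, fderiv_coord_y, Finset.sum_add_distrib]
    ring

theorem differentiableAt_φstd {W : VecF n} {p : Pt n} (hW : DifferentiableAt ℝ W p) :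
    DifferentiableAt ℝ (φstd W) p :=
  hW.snd.fst.prodMk (hW.fst.neg.prodMk
    (differentiableAt_dotProduct (differentiableAt_y p) hW.snd.fst))

theorem fderiv_φstd {W : VecF n} {p : Pt n} (hW : DifferentiableAt ℝ W p) (v : Pt n) :
    fderiv ℝ (φstd W) p v =
      ((fderiv ℝ W p v).2.1, -(fderiv ℝ W p v).1,
        ∑ k, (v.2.1 k * (W p).2.1 k + p.2.1 k * (fderiv ℝ W p v).2.1 k)) := by
  have h := differentiableAt_φstd hW
  refine Prod.ext ?_ (Prod.ext ?_ ?_)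
  · rw [← fderiv_x h, ← fderiv_y hW]; rfl
  · rw [← fderiv_y h, ← fderiv_x hW]
    simp [φstd, fderiv_fun_neg]
  · rw [← fderiv_z h]
    simp only [φstd]
    rw [fderiv_dotProduct (differentiableAt_y p) hW.snd.fst, fderiv_coord_y, fderiv_y hW]

theorem smoothVF_ξstd : SmoothVF (ξstd : VecF n) := contDiff_const

theorem fderiv_ξstd (p : Pt n) : fderiv ℝ (ξstd : VecF n) p = 0 :=
  fderiv_const_apply (𝕜 := ℝ) ((0, 0, 1) : Pt n)

theorem hstd_eq_zero {W : VecF n} (hW : SmoothVF W) : hstd W = 0 := by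
  funext p
  have h := hW.differentiableAt p
  have e : brkt ξstd (φstd W) p = φstd (brkt ξstd W) p := by
    simp [brkt, fderiv_ξstd, fderiv_φstd h, φstd, ξstd]
  simp [hstd, e]

theorem fderiv_memL {W : VecF n} (hW : memL W) {p : Pt n} (h : DifferentiableAt ℝ W p)
    (v : Pt n) : (fderiv ℝ W p v).1 = 0 ∧ (fderiv ℝ W p v).2.2 = 0 := by
  rw [← fderiv_x h, ← fderiv_z h]
  simp [fun q => (hW q).1, fun q => (hW q).2]

theorem fderiv_memQ {W : VecF n} (hW : memQ W) {p : Pt n} (h : DifferentiableAt ℝ W p)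
    (v : Pt n) : (fderiv ℝ W p v).2.1 = 0 ∧ (fderiv ℝ W p v).2.2 =
      ∑ k, (fderiv ℝ W p v).1 k * p.2.1 k + ∑ k, (W p).1 k * v.2.1 k := by
  rw [← fderiv_y h, ← fderiv_z h]
  simp only [fun q => (hW q).1, fun q => (hW q).2]
  rw [fderiv_dotProduct h.fst (differentiableAt_y p), fderiv_coord_y, fderiv_x h,
    Finset.sum_add_distrib]
  simp

theorem memL_brkt {W W' : VecF n} (h : SmoothVF W) (h' : SmoothVF W') (hW : memL W)
    (hW' : memL W') : memL (brkt W W') := fun p => by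
  simp [brkt, fderiv_memL hW (h.differentiableAt p), fderiv_memL hW' (h'.differentiableAt p)]

theorem memQ_brkt {W W' : VecF n} (h : SmoothVF W) (h' : SmoothVF W') (hW : memQ W)
    (hW' : memQ W') : memQ (brkt W W') := fun p => by
  simp [brkt, fderiv_memQ hW (h.differentiableAt p), fderiv_memQ hW' (h'.differentiableAt p),
    (hW p).1, (hW' p).1, sub_mul]

theorem memL_brkt_ξstd {W : VecF n} (h : SmoothVF W) (hW : memL W) :
    memL (brkt ξstd W) := fun p => by
  simp [brkt, fderiv_ξstd, fderiv_memL hW (h.differentiableAt p)]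

theorem memQ_brkt_ξstd {W : VecF n} (h : SmoothVF W) (hW : memQ W) :
    memQ (brkt ξstd W) := fun p => by
  simp [brkt, fderiv_ξstd, fderiv_memQ hW (h.differentiableAt p), ξstd]

theorem memL_bilegStd (Z : VecF n) {W : VecF n} (h : SmoothVF W) (hW : memL W) :
    memL (bilegStd Z W) := fun p => by
  simp [bilegStd_apply (h.differentiableAt p), fderiv_memL hW (h.differentiableAt p), (hW p).1]

theorem memQ_bilegStd (Z : VecF n) {W : VecF n} (h : SmoothVF W) (hW : memQ W) :
    memQ (bilegStd Z W) := fun p => by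
  simp [bilegStd_apply (h.differentiableAt p), fderiv_memQ hW (h.differentiableAt p)]

theorem ηstd_bilegStd {W : VecF n} (hW : SmoothVF W) (Z : VecF n) :
    ηstd (bilegStd Z W) = actD Z (ηstd W) := by
  funext p
  have h := hW.differentiableAt p
  have hy := differentiableAt_y p
  simp only [actD]
  unfold ηstd
  simp only [bilegStd_apply h]
  rw [fderiv_fun_sub h.snd.snd (differentiableAt_dotProduct hy h.fst),
    sub_apply, fderiv_z h, fderiv_dotProduct hy h.fst,
    fderiv_x h, fderiv_coord_y, Finset.sum_add_distrib]
  simp only [Prod.snd_sub, Prod.fst_sub, sub_zero]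
  simp only [mul_comm ((W p).1 _)]
  ring

theorem differentiableAt_ηstd {W : VecF n} {p : Pt n} (h : DifferentiableAt ℝ W p) :
    DifferentiableAt ℝ (ηstd W) p :=
  h.snd.snd.sub (differentiableAt_dotProduct (differentiableAt_y p) h.fst)

theorem actD_dηstd {W W' : VecF n} (hW : SmoothVF W) (hW' : SmoothVF W') (Z : VecF n) :
    actD Z (dηstd W W') =
      fun p => dηstd (bilegStd Z W) W' p + dηstd W (bilegStd Z W') p := by
  funext p
  have h := hW.differentiableAt p
  have h' := hW'.differentiableAt p
  simp only [actD]
  unfold dηstd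
  simp only [bilegStd_apply h, bilegStd_apply h', Finset.sum_sub_distrib]
  have d1 := differentiableAt_dotProduct h.fst h'.snd.fst
  have d2 := differentiableAt_dotProduct h.snd.fst h'.fst
  rw [fderiv_const_mul (d1.fun_sub d2), smul_apply, fderiv_fun_sub d1 d2,
    sub_apply, fderiv_dotProduct h.fst h'.snd.fst,
    fderiv_dotProduct h.snd.fst h'.fst, fderiv_x h, fderiv_x h', fderiv_y h, fderiv_y h']
  simp only [Finset.sum_add_distrib, Prod.fst_sub, Prod.snd_sub, sub_zero, smul_eq_mul]
  ring

theorem actD_gstd {W W' : VecF n} (hW : SmoothVF W) (hW' : SmoothVF W') (Z : VecF n) :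
    actD Z (gstd W W') =
      fun p => gstd (bilegStd Z W) W' p + gstd W (bilegStd Z W') p := by
  funext p
  have h := hW.differentiableAt p
  have h' := hW'.differentiableAt p
  simp only [actD]
  unfold gstd
  simp only [actD, ηstd_bilegStd hW, ηstd_bilegStd hW', bilegStd_apply h, bilegStd_apply h']
  have d1 := differentiableAt_dotProduct h.fst h'.fst
  have d2 := differentiableAt_dotProduct h.snd.fst h'.snd.fst
  have e := (differentiableAt_ηstd h).fun_mul (differentiableAt_ηstd h')
  rw [fderiv_fun_add e ((d1.fun_add d2).const_mul _), add_apply,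
    fderiv_fun_mul (differentiableAt_ηstd h) (differentiableAt_ηstd h'),
    fderiv_const_mul (d1.fun_add d2), smul_apply, fderiv_fun_add d1 d2,
    add_apply, add_apply, fderiv_dotProduct h.fst h'.fst,
    fderiv_dotProduct h.snd.fst h'.snd.fst, fderiv_x h, fderiv_x h', fderiv_y h, fderiv_y h']
  simp only [Finset.sum_add_distrib, Prod.fst_sub, Prod.snd_sub, sub_zero, smul_eq_mul,
    smul_apply]
  ring

theorem bilegStd_φstd {W : VecF n} (hW : SmoothVF W) (Z : VecF n) :
    bilegStd Z (φstd W) = φstd (bilegStd Z W) := by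
  funext p
  have h := hW.differentiableAt p
  rw [bilegStd_apply (differentiableAt_φstd h), fderiv_φstd h]
  simp [φstd, bilegStd_apply h, Finset.sum_add_distrib, mul_comm ((Z p).2.1 _)]

theorem bilegStd_ξstd (Z : VecF n) : bilegStd Z ξstd = fun _ => 0 := by
  funext p
  rw [bilegStd_apply (smoothVF_ξstd.differentiableAt p)]
  simp [fderiv_ξstd, ξstd]

theorem torsionD_bilegStd {X Y : VecF n} (hX : SmoothVF X) (hY : SmoothVF Y) :
    torsionD bilegStd X Y = fun p => (2 * dηstd X Y p) • ξstd p := by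
  funext p
  simp only [torsionD, brkt, bilegStd_apply (hX.differentiableAt p),
    bilegStd_apply (hY.differentiableAt p), dηstd, ξstd]
  refine Prod.ext ?_ (Prod.ext ?_ ?_)
  · simp
  · simp
  · simp only [Prod.snd_sub, Prod.smul_snd, smul_eq_mul, Finset.sum_sub_distrib,
      mul_comm ((Y p).1 _)]
    ring

theorem torsionD_bilegStd_ξstd {W : VecF n} (hW : SmoothVF W) :
    torsionD bilegStd W ξstd =
      fun p => projQ (brkt ξstd (projL W)) p + projL (brkt ξstd (projQ W)) p := by
  rw [torsionD_bilegStd hW smoothVF_ξstd]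
  funext p
  have h := hW.differentiableAt p
  have hL : DifferentiableAt ℝ (projL W) p :=
    (differentiableAt_const _).prodMk (h.snd.fst.prodMk (differentiableAt_const _))
  have hQ : DifferentiableAt ℝ (projQ W) p :=
    h.fst.prodMk ((differentiableAt_const _).prodMk
      (differentiableAt_dotProduct h.fst (differentiableAt_y p)))
  have eL : (brkt ξstd (projL W) p).1 = 0 := by
    simp [brkt, fderiv_ξstd, ← fderiv_x hL]
    simp [projL]
  have eQ : (brkt ξstd (projQ W) p).2.1 = 0 := by
    simp [brkt, fderiv_ξstd, ← fderiv_y hQ]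
    simp [projQ]
  rw [projQ, projL, eL, eQ]
  simp [dηstd, ξstd, Prod.ext_iff]

theorem bilegStd_curvature_eq_zero {X Y Z : VecF n} (hX : SmoothVF X) (hY : SmoothVF Y)
    (hZ : SmoothVF Z) :
    (fun p => bilegStd X (bilegStd Y Z) p - bilegStd Y (bilegStd X Z) p -
      bilegStd (brkt X Y) Z p) = fun _ => (0 : Pt n) := by
  funext p
  have hZp := hZ.differentiableAt p
  have hdZ : DifferentiableAt ℝ (fderiv ℝ Z) p :=
    (ContDiff.fderiv_right (m := 1) hZ (by norm_cast)).differentiable one_ne_zero p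
  have hsymm : IsSymmSndFDerivAt ℝ Z p :=
    (ContDiff.contDiffAt hZ).isSymmSndFDerivAt (by simp; norm_cast)
  have key : ∀ A B : VecF n, SmoothVF A → SmoothVF B → bilegStd A (bilegStd B Z) p =
      fderiv ℝ (fderiv ℝ Z) p (A p) (B p) + fderiv ℝ Z p (fderiv ℝ B p (A p)) -
        ((0, 0, ∑ k, (fderiv ℝ Z p (A p)).1 k * (B p).2.1 k +
          ∑ k, (Z p).1 k * (fderiv ℝ B p (A p)).2.1 k +
          ∑ k, (fderiv ℝ Z p (B p)).1 k * (A p).2.1 k) : Pt n) := by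
    intro A B hA hB
    have hBp := hB.differentiableAt p
    have e : bilegStd B Z = fun q =>
        fderiv ℝ Z q (B q) - ((0, 0, ∑ k, (Z q).1 k * (B q).2.1 k) : Pt n) := by
      funext q; exact bilegStd_apply (hZ.differentiableAt q) B
    have d1 : DifferentiableAt ℝ (fun q => fderiv ℝ Z q (B q)) p := hdZ.clm_apply hBp
    have ds := differentiableAt_dotProduct hZp.fst hBp.snd.fst
    have d2 := (hasFDerivAt_const (0 : Fin n → ℝ) p).prodMk
      ((hasFDerivAt_const (0 : Fin n → ℝ) p).prodMk ds.hasFDerivAt)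
    have d := d1.sub d2.differentiableAt
    rw [bilegStd_apply (e ▸ d), e, fderiv_fun_sub d1 d2.differentiableAt, d2.fderiv,
      fderiv_clm_apply hdZ hBp]
    simp only [sub_apply, ContinuousLinearMap.prod_apply,
      fderiv_dotProduct hZp.fst hBp.snd.fst, fderiv_x hZp, fderiv_y hBp,
      Finset.sum_add_distrib, add_apply, ContinuousLinearMap.comp_apply,
      ContinuousLinearMap.flip_apply, zero_apply, Prod.fst_sub, sub_zero]
    refine Prod.ext ?_ (Prod.ext ?_ ?_)
    · simp [add_comm]
    · simp [add_comm]
    · simp only [Prod.snd_sub, Prod.snd_add]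
      ring
  simp only [key X Y hX hY, key Y X hY hX, bilegStd_apply hZp, brkt, hsymm.eq (Y p) (X p),
    map_sub]
  refine Prod.ext ?_ (Prod.ext ?_ ?_)
  · simp
  · simp
  · simp only [Prod.snd_sub, Prod.snd_add, Prod.fst_sub, Pi.sub_apply, mul_sub,
      Finset.sum_sub_distrib, Prod.snd_zero]
    ring

theorem gstd_comm (X Y : VecF n) (p : Pt n) : gstd X Y p = gstd Y X p := by
  simp only [gstd, mul_comm]

theorem gstd_add_left (X X' Y : VecF n) (p : Pt n) :
    gstd (fun q => X q + X' q) Y p = gstd X Y p + gstd X' Y p := by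
  simp only [gstd, ηstd, Prod.fst_add, Prod.snd_add, Pi.add_apply, add_mul, mul_add,
    Finset.sum_add_distrib]
  ring

theorem gstd_smul_left (f : Func n) (X Y : VecF n) (p : Pt n) :
    gstd (fun q => f q • X q) Y p = f p * gstd X Y p := by
  simp only [gstd, ηstd, Prod.smul_fst, Prod.smul_snd, Pi.smul_apply, smul_eq_mul,
    mul_left_comm _ (f p), mul_assoc (f p), ← Finset.mul_sum]
  ring

theorem gstd_sub_left (X X' Y : VecF n) (p : Pt n) :
    gstd (fun q => X q - X' q) Y p = gstd X Y p - gstd X' Y p := by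
  have h := gstd_add_left (fun q => X q - X' q) X' Y p
  simp only [sub_add_cancel] at h
  linarith

theorem gstd_φstd_left (X Y : VecF n) (p : Pt n) : gstd (φstd X) Y p = dηstd Y X p := by
  simp [gstd, ηstd, φstd, dηstd, mul_comm, sub_eq_add_neg, Finset.sum_add_distrib]

theorem gstd_ξstd_left (Y : VecF n) (p : Pt n) : gstd ξstd Y p = ηstd Y p := by
  simp [gstd, ξstd, ηstd]

theorem dηstd_swap (X Y : VecF n) (p : Pt n) : dηstd Y X p = -dηstd X Y p := by
  simp only [dηstd, Finset.sum_sub_distrib, mul_comm ((Y p).1 _), mul_comm ((Y p).2.1 _)]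
  ring

theorem eq_zero_of_gstd_const_eq_zero (X : VecF n) (p : Pt n)
    (h : ∀ v : Pt n, gstd X (fun _ => v) p = 0) : X p = 0 := by
  have h0 : gstd X X p = 0 := h (X p)
  have s1 : 0 ≤ ∑ k, (X p).1 k * (X p).1 k :=
    Finset.sum_nonneg fun k _ => mul_self_nonneg _
  have s2 : 0 ≤ ∑ k, (X p).2.1 k * (X p).2.1 k :=
    Finset.sum_nonneg fun k _ => mul_self_nonneg _
  have s3 := mul_self_nonneg (ηstd X p)
  simp only [gstd] at h0
  have e1 : (X p).1 = 0 := by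
    have : ∑ k, (X p).1 k * (X p).1 k = 0 := by linarith
    funext k
    simpa using (Finset.sum_eq_zero_iff_of_nonneg fun k _ => mul_self_nonneg _).1 this k
      (Finset.mem_univ k)
  have e2 : (X p).2.1 = 0 := by
    have : ∑ k, (X p).2.1 k * (X p).2.1 k = 0 := by linarith
    funext k
    simpa using (Finset.sum_eq_zero_iff_of_nonneg fun k _ => mul_self_nonneg _).1 this k
      (Finset.mem_univ k)
  have e3 : ηstd X p = 0 := mul_self_eq_zero.1 (by linarith)
  refine Prod.ext e1 (Prod.ext e2 ?_)
  simpa [ηstd, e1] using e3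

/-- Uniqueness of the Levi-Civita connection of `g`. -/
theorem leviCivita_unique {D D' : VecF n → VecF n → VecF n}
    (ht : ∀ X Y : VecF n, SmoothVF X → SmoothVF Y → (fun p => D X Y p - D Y X p) = brkt X Y)
    (ht' : ∀ X Y : VecF n, SmoothVF X → SmoothVF Y →
      (fun p => D' X Y p - D' Y X p) = brkt X Y)
    (hg : ∀ Z X Y : VecF n, SmoothVF Z → SmoothVF X → SmoothVF Y →
      actD Z (gstd X Y) = fun p => gstd (D Z X) Y p + gstd X (D Z Y) p)
    (hg' : ∀ Z X Y : VecF n, SmoothVF Z → SmoothVF X → SmoothVF Y →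
      actD Z (gstd X Y) = fun p => gstd (D' Z X) Y p + gstd X (D' Z Y) p)
    {X Y : VecF n} (hX : SmoothVF X) (hY : SmoothVF Y) : D X Y = D' X Y := by
  let A : VecF n → VecF n → VecF n := fun X Y q => D X Y q - D' X Y q
  have symm : ∀ X Y, SmoothVF X → SmoothVF Y → A X Y = A Y X := by
    intro X Y hX hY
    funext p
    have h := congrFun ((ht X Y hX hY).trans (ht' X Y hX hY).symm) p
    exact sub_eq_sub_iff_sub_eq_sub.1 h
  have skew : ∀ Z X Y, SmoothVF Z → SmoothVF X → SmoothVF Y → ∀ p,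
      gstd (A Z X) Y p = -gstd (A Z Y) X p := by
    intro Z X Y hZ hX hY p
    have h := congrFun ((hg Z X Y hZ hX hY).symm.trans (hg' Z X Y hZ hX hY)) p
    simp only [gstd_comm X] at h
    simp only [A, gstd_sub_left]
    linarith
  funext p
  refine sub_eq_zero.1 (eq_zero_of_gstd_const_eq_zero (A X Y) p fun v => ?_)
  have hV : SmoothVF (fun _ : Pt n => v) := contDiff_const
  have h1 := skew X Y _ hX hY hV p
  have h2 := skew _ X Y hV hX hY p
  have h3 := skew Y _ X hY hV hX p
  rw [symm _ X hV hX, symm _ Y hV hY] at h2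
  rw [symm Y X hY hX] at h3
  linarith

/-- The difference between the Tanaka-Webster and Levi-Civita connections (when `h = 0`). -/
def twDiff (X Y : VecF n) : VecF n := fun p =>
  ηstd X p • φstd Y p + ηstd Y p • φstd X p + dηstd X Y p • ξstd p

theorem twStd_eq_add_twDiff (lc : VecF n → VecF n → VecF n) {X : VecF n} (hX : SmoothVF X)
    (Y : VecF n) (p : Pt n) : twStd lc X Y p = lc X Y p + twDiff X Y p := by
  have e : φstd (0 : VecF n) p = 0 := by simp [φstd]
  simp only [twStd, hstd_eq_zero hX, add_zero, twDiff, e, add_assoc]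

theorem gstd_twDiff_left (Z X Y : VecF n) (p : Pt n) :
    gstd (twDiff Z X) Y p =
      ηstd Z p * dηstd Y X p + ηstd X p * dηstd Y Z p + dηstd Z X p * ηstd Y p := by
  unfold twDiff
  rw [gstd_add_left, gstd_add_left, gstd_smul_left, gstd_smul_left, gstd_smul_left,
    gstd_φstd_left, gstd_φstd_left, gstd_ξstd_left]

theorem bilegStd_eq_twStd {lc : VecF n → VecF n → VecF n}
    (ht : ∀ X Y : VecF n, SmoothVF X → SmoothVF Y →
      (fun p => lc X Y p - lc Y X p) = brkt X Y)
    (hg : ∀ Z X Y : VecF n, SmoothVF Z → SmoothVF X → SmoothVF Y →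
      actD Z (gstd X Y) = fun p => gstd (lc Z X) Y p + gstd X (lc Z Y) p)
    {X Y : VecF n} (hX : SmoothVF X) (hY : SmoothVF Y) :
    bilegStd X Y = twStd lc X Y := by
  have h : (fun p => bilegStd X Y p - twDiff X Y p) = lc X Y := by
    refine leviCivita_unique (D := fun X Y p => bilegStd X Y p - twDiff X Y p)
      ?_ ht ?_ hg hX hY
    · intro X Y hX hY
      funext p
      have h := congrFun (torsionD_bilegStd hX hY) p
      simp only [torsionD] at h
      have e : twDiff X Y p - twDiff Y X p = (2 * dηstd X Y p) • ξstd p := by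
        simp only [twDiff, dηstd_swap X Y]
        module
      rw [← e] at h
      rw [← sub_eq_zero] at h ⊢
      rw [← h]
      abel
    · intro Z X Y _ hX hY
      rw [actD_gstd hX hY]
      funext p
      simp only [gstd_comm X, gstd_sub_left, gstd_twDiff_left]
      rw [dηstd_swap X Y, dηstd_swap Z X, dηstd_swap Z Y]
      ring
  funext p
  rw [twStd_eq_add_twDiff lc hX, ← h]
  simp

/-- Example.  For the standard Sasakian structure
`(φ, ξ, η, g)` on `ℝ^{2n+1}` and the standard bi-Legendrian structure
`(L, Q)`:  `L` and `Q` are two orthogonal flat Legendrian foliations, the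
associated bi-Legendrian connection `∇` (which satisfies the characterizing
properties of the bi-Legendrian connection of `(L, Q)`) satisfies `∇φ = 0`
and `∇g = 0`, it coincides with the Tanaka-Webster connection of
`(ℝ^{2n+1}, φ, ξ, η, g)`, and consequently the Tanaka-Webster connection of
the standard Sasakian `ℝ^{2n+1}` is everywhere flat. -/
theorem standard_sasakian_biLegendrian_eq_tanakaWebster (n : ℕ) :
    -- L is a Legendrian distribution: contained in ker η, dη vanishes on it,
    (∀ W : VecF n, memL W → ∀ p, ηstd W p = 0) ∧
    (∀ W W' : VecF n, memL W → memL W' → ∀ p, dηstd W W' p = 0) ∧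
    -- Q is a Legendrian distribution,
    (∀ W : VecF n, memQ W → ∀ p, ηstd W p = 0) ∧
    (∀ W W' : VecF n, memQ W → memQ W' → ∀ p, dηstd W W' p = 0) ∧
    -- Q = φL,
    (∀ W : VecF n, memL W → memQ (φstd W)) ∧
    (∀ W : VecF n, memQ W → memL (φstd W)) ∧
    -- L and Q are orthogonal,
    (∀ W W' : VecF n, memL W → memQ W' → ∀ p, gstd W W' p = 0) ∧
    -- L and Q are foliations (integrable) and flat,
    (∀ W W' : VecF n, SmoothVF W → SmoothVF W' → memL W → memL W' →
      memL (brkt W W')) ∧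
    (∀ W W' : VecF n, SmoothVF W → SmoothVF W' → memQ W → memQ W' →
      memQ (brkt W W')) ∧
    (∀ W : VecF n, SmoothVF W → memL W → memL (brkt ξstd W)) ∧
    (∀ W : VecF n, SmoothVF W → memQ W → memQ (brkt ξstd W)) ∧
    -- ∇ is the bi-Legendrian connection of (L, Q): it preserves L, Q and ℝξ,
    (∀ Z W : VecF n, SmoothVF W → memL W → memL (bilegStd Z W)) ∧
    (∀ Z W : VecF n, SmoothVF W → memQ W → memQ (bilegStd Z W)) ∧
    (∀ Z : VecF n, bilegStd Z ξstd = fun _ => 0) ∧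
    -- it parallelizes dη,
    (∀ Z W W' : VecF n, SmoothVF Z → SmoothVF W → SmoothVF W' →
      actD Z (dηstd W W') =
        fun p => dηstd (bilegStd Z W) W' p + dηstd W (bilegStd Z W') p) ∧
    -- and its torsion satisfies T(X,Y) = 2dη(X,Y)ξ for X ∈ L, Y ∈ Q and
    -- T(W,ξ) = [ξ,W_L]_Q + [ξ,W_Q]_L,
    (∀ X Y : VecF n, SmoothVF X → SmoothVF Y → memL X → memQ Y →
      torsionD bilegStd X Y = fun p => (2 * dηstd X Y p) • ξstd p) ∧
    (∀ W : VecF n, SmoothVF W →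
      torsionD bilegStd W ξstd =
        fun p => projQ (brkt ξstd (projL W)) p + projL (brkt ξstd (projQ W)) p) ∧
    -- ∇φ = 0 and ∇g = 0,
    (∀ Z W : VecF n, SmoothVF Z → SmoothVF W →
      bilegStd Z (φstd W) = φstd (bilegStd Z W)) ∧
    (∀ Z W W' : VecF n, SmoothVF Z → SmoothVF W → SmoothVF W' →
      actD Z (gstd W W') =
        fun p => gstd (bilegStd Z W) W' p + gstd W (bilegStd Z W') p) ∧
    -- ∇ coincides with the Tanaka-Webster connection (computed from any
    -- torsion-free metric connection ∇̂, i.e. from the Levi-Civita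
    -- connection of g),
    (∀ lc : VecF n → VecF n → VecF n,
      (∀ X Y : VecF n, SmoothVF X → SmoothVF Y →
        (fun p => lc X Y p - lc Y X p) = brkt X Y) →
      (∀ Z X Y : VecF n, SmoothVF Z → SmoothVF X → SmoothVF Y →
        actD Z (gstd X Y) = fun p => gstd (lc Z X) Y p + gstd X (lc Z Y) p) →
      ∀ X Y : VecF n, SmoothVF X → SmoothVF Y →
        bilegStd X Y = twStd lc X Y) ∧
    -- consequently the Tanaka-Webster connection of the standard Sasakian
    -- ℝ^{2n+1} is everywhere flat: its curvature vanishes identically.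
    (∀ X Y Z : VecF n, SmoothVF X → SmoothVF Y → SmoothVF Z →
      (fun p => bilegStd X (bilegStd Y Z) p - bilegStd Y (bilegStd X Z) p -
        bilegStd (brkt X Y) Z p) = fun _ => (0 : Pt n)) := by
  refine ⟨?_, ?_, ?_, ?_, ?_, ?_, ?_, fun W W' => memL_brkt, fun W W' => memQ_brkt,
    fun W => memL_brkt_ξstd, fun W => memQ_brkt_ξstd, fun Z W => memL_bilegStd Z,
    fun Z W => memQ_bilegStd Z, bilegStd_ξstd, fun Z W W' _ h h' => actD_dηstd h h' Z,
    fun X Y hX hY _ _ => torsionD_bilegStd hX hY, fun W => torsionD_bilegStd_ξstd,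
    fun Z W _ h => bilegStd_φstd h Z, fun Z W W' _ h h' => actD_gstd h h' Z,
    fun lc ht hg X Y => bilegStd_eq_twStd ht hg, fun X Y Z => bilegStd_curvature_eq_zero⟩
  · intro W h p
    simp [ηstd, h p]
  · intro W W' h h' p
    simp [dηstd, h p, h' p]
  · intro W h p
    simp [ηstd, h p, mul_comm]
  · intro W W' h h' p
    simp [dηstd, h p, h' p]
  · intro W h p
    simp [φstd, h p, mul_comm]
  · intro W h p
    simp [φstd, h p]
  · intro W W' h h' p
    simp [gstd, ηstd, h p, h' p, mul_comm]
end
end
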